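/- Let (T,m) be a complete local reduced Gorenstein ring of prime characteristic p > 0 with dim T ≥ 1. Let I ⊆ T be a parameter ideal and let y ∈ T generate the socle of T/I, and suppose y^{p^e} ∉ I^{[p^e]} for all e. Then there exists an F-regular local unique factorization domain A whose completion is isomorphic to the power series ring T[[X]]. -/

import Mathlib

open IsLocalRing

/-- The `q`-th Frobenius power `I^{[q]}` of an ideal: the ideal generated by `q`-th powers of
elements of `I`. -/
def Ideal.frobPow {R : Type*} [CommRing R] (I : Ideal R) (q : ℕ) : Ideal R :=
  Ideal.span ((fun r => r ^ q) '' (I : Set R))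

/-- Membership in the tight closure `I*` of an ideal `I` in a ring of characteristic `p`:
there is a `c` outside every minimal prime with `c * x^{p^e} ∈ I^{[p^e]}` for all `e ≫ 0`. -/
def Ideal.MemTightClosure {R : Type*} [CommRing R] (p : ℕ) (I : Ideal R) (x : R) : Prop :=
  ∃ c : R, (∀ P ∈ minimalPrimes R, c ∉ P) ∧
    ∃ E : ℕ, ∀ e : ℕ, E ≤ e → c * x ^ p ^ e ∈ I.frobPow (p ^ e)

/-- A ring of characteristic `p` is weakly F-regular if every ideal is tightly closed. -/
def WeaklyFRegular (R : Type*) [CommRing R] (p : ℕ) : Prop :=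
  ∀ (I : Ideal R) (x : R), I.MemTightClosure p x → x ∈ I

/-- A ring is F-regular if all of its localizations are weakly F-regular. -/
def FRegular (R : Type*) [CommRing R] (p : ℕ) : Prop :=
  ∀ S : Submonoid R, WeaklyFRegular (Localization S) p

/-- A ring is catenary if any two saturated chains of primes with the same endpoints have
the same length. -/
def IsCatenaryRing (R : Type*) [CommRing R] : Prop :=
  ∀ (n m : ℕ) (f : Fin (n + 1) → PrimeSpectrum R) (g : Fin (m + 1) → PrimeSpectrum R),
    f 0 = g 0 → f (Fin.last n) = g (Fin.last m) →
    (∀ i : Fin n, f i.castSucc ⋖ f i.succ) → (∀ i : Fin m, g i.castSucc ⋖ g i.succ) →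
    n = m

/-- `y` generates the socle of `T/I`, i.e. `(I : m) = I + (y)` and `y ∉ I`. -/
def IsSocleGenerator {T : Type*} [CommRing T] [IsLocalRing T] (I : Ideal T) (y : T) : Prop :=
  y ∉ I ∧ I.colon (maximalIdeal T) = I ⊔ Ideal.span {y}

/-- An approximately Gorenstein sequence: a descending chain of `m`-primary ideals with
Gorenstein quotients, cofinal with the powers of `m`. -/
def IsApproxGorensteinSeq (T : Type*) [CommRing T] [IsLocalRing T] (I : ℕ → Ideal T) : Prop :=
  Antitone I ∧ (∀ s, (I s).radical = maximalIdeal T) ∧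
  (∀ s, ∃ y, IsSocleGenerator (I s) y) ∧
  ∀ N : ℕ, ∃ S : ℕ, ∀ s : ℕ, S ≤ s → I s ≤ maximalIdeal T ^ N

/-- The set `M_{I,y} = ⋃_{e ≥ 1} ⋂_{f ≥ e} (I^{[p^f]} : y^{p^f})`. -/
def MIy {T : Type*} [CommRing T] (p : ℕ) (I : Ideal T) (y : T) : Set T :=
  {c : T | ∃ e : ℕ, 1 ≤ e ∧ ∀ f : ℕ, e ≤ f → c * y ^ p ^ f ∈ I.frobPow (p ^ f)}

/-- `depth T ≥ n`: there is a regular sequence of length `n` in the maximal ideal. -/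
def DepthGE (T : Type*) [CommRing T] [IsLocalRing T] (n : ℕ) : Prop :=
  ∃ rs : List T, rs.length = n ∧ (∀ x ∈ rs, x ∈ maximalIdeal T) ∧
    RingTheory.Sequence.IsRegular T rs

/-- A Noetherian local ring is Cohen–Macaulay iff there is a regular sequence in the maximal
ideal of length equal to the Krull dimension. -/
def IsCohenMacaulayLocal (T : Type*) [CommRing T] [IsLocalRing T] : Prop :=
  ∃ rs : List T, (∀ x ∈ rs, x ∈ maximalIdeal T) ∧ RingTheory.Sequence.IsRegular T rs ∧
    (rs.length : WithBot (WithTop ℕ)) = ringKrullDim T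

/-- A parameter ideal: generated by `dim T` elements, with radical the maximal ideal. -/
def IsParameterIdeal (T : Type*) [CommRing T] [IsLocalRing T] (I : Ideal T) : Prop :=
  ∃ (n : ℕ) (x : Fin n → T), I = Ideal.span (Set.range x) ∧ I.radical = maximalIdeal T ∧
    (n : WithBot (WithTop ℕ)) = ringKrullDim T

/-- A Noetherian local ring is Gorenstein iff it is Cohen–Macaulay and every parameter ideal
is irreducible (has one-dimensional socle). -/
def IsGorensteinLocal (T : Type*) [CommRing T] [IsLocalRing T] : Prop :=
  IsCohenMacaulayLocal T ∧ ∀ I : Ideal T, IsParameterIdeal T I → ∃ y, IsSocleGenerator I y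

/-- A `p`-subring of a local ring `T`: a quasi-local subring `(R, R ∩ m)` which is small,
misses `p`, and misses every associated prime of `T`. -/
def IsPSubring (T : Type*) [CommRing T] [IsLocalRing T] (P : Ideal T) (R : Subring T) : Prop :=
  IsLocalRing R ∧ (Ideal.comap R.subtype (maximalIdeal T)).IsMaximal ∧
  (Cardinal.mk R ≤ max Cardinal.aleph0 (Cardinal.mk (ResidueField T)) ∧
    (Cardinal.mk R = max Cardinal.aleph0 (Cardinal.mk (ResidueField T)) →
      Cardinal.mk (ResidueField T) ≤ Cardinal.aleph0)) ∧
  Ideal.comap R.subtype P = ⊥ ∧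
  ∀ Q ∈ associatedPrimes T T, Ideal.comap R.subtype Q = ⊥

/-- An N-subring of a local ring `T`: a quasi-local UFD `(R, R ∩ m)` inside `T` which is small,
misses every associated prime of `T`, and such that `R ∩ J` has height at most one for every
`J ∈ Ass(T/tT)`, `t` a nonzerodivisor. -/
def IsNSubring (T : Type*) [CommRing T] [IsLocalRing T] (R : Subring T) : Prop :=
  IsLocalRing R ∧ (Ideal.comap R.subtype (maximalIdeal T)).IsMaximal ∧
  (∃ _ : IsDomain R, UniqueFactorizationMonoid R) ∧
  (Cardinal.mk R ≤ max Cardinal.aleph0 (Cardinal.mk (ResidueField T)) ∧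
    (Cardinal.mk R = max Cardinal.aleph0 (Cardinal.mk (ResidueField T)) →
      Cardinal.mk (ResidueField T) ≤ Cardinal.aleph0)) ∧
  (∀ Q ∈ associatedPrimes T T, Ideal.comap R.subtype Q = ⊥) ∧
  ∀ t ∈ nonZeroDivisors T, ∀ J ∈ associatedPrimes T (T ⧸ Ideal.span {t}),
    ∀ q0 q1 : Ideal R, q0.IsPrime → q1.IsPrime →
      ¬(q0 < q1 ∧ q1 < Ideal.comap R.subtype J)

universe u

/-- `r` is a nonzerodivisor modulo the ideal `I`. -/
def RegularMod {R : Type*} [CommRing R] (I : Ideal R) (r : R) : Prop :=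
  ∀ a, r * a ∈ I → a ∈ I

/-- `P` is a prime of the form `(I : a)`. -/
def IsAssMod {R : Type*} [CommRing R] (I P : Ideal R) : Prop :=
  P.IsPrime ∧ ∃ a, ∀ s, s ∈ P ↔ s * a ∈ I

section RegularMod

variable {R : Type*} [CommRing R]

theorem RegularMod.mul {I : Ideal R} {r s : R} (hr : RegularMod I r) (hs : RegularMod I s) :
    RegularMod I (r * s) := fun a h => hs a (hr _ (by rwa [← mul_assoc]))

theorem RegularMod.of_mul_left {I : Ideal R} {r s : R} (h : RegularMod I (r * s)) :
    RegularMod I r := fun a ha => h a (by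
      rw [mul_right_comm, mul_comm]; exact I.mul_mem_left _ ha)

theorem RegularMod.pow {I : Ideal R} {r : R} (hr : RegularMod I r) (n : ℕ) :
    RegularMod I (r ^ n) := by
  induction n with
  | zero => intro a h; simpa using h
  | succ n ih => rw [pow_succ]; exact ih.mul hr

theorem mem_sup_span_singleton {I : Ideal R} {x a : R} :
    a ∈ I ⊔ Ideal.span {x} ↔ ∃ b, a - x * b ∈ I := by
  rw [sup_comm, Submodule.mem_sup]
  constructor
  · rintro ⟨y, hy, z, hz, rfl⟩
    obtain ⟨b, rfl⟩ := Ideal.mem_span_singleton.1 hy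
    exact ⟨b, by simpa using hz⟩
  · rintro ⟨b, hb⟩
    exact ⟨x * b, Ideal.mem_span_singleton.2 ⟨b, rfl⟩, _, hb, by ring⟩

theorem RegularMod.exchange {I : Ideal R} {r z : R} (hr : RegularMod I r)
    (hz : RegularMod (I ⊔ Ideal.span {r}) z) : RegularMod (I ⊔ Ideal.span {z}) r := by
  intro a ha
  obtain ⟨b, hb⟩ := mem_sup_span_singleton.1 ha
  have hzb : z * b ∈ I ⊔ Ideal.span {r} :=
    mem_sup_span_singleton.2 ⟨a, by simpa using I.neg_mem hb⟩
  obtain ⟨c, hc⟩ := mem_sup_span_singleton.1 (hz b hzb)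
  refine mem_sup_span_singleton.2 ⟨c, hr _ ?_⟩
  have : r * (a - z * c) = (r * a - z * b) + z * (b - r * c) := by ring
  rw [this]
  exact I.add_mem hb (I.mul_mem_left _ hc)

theorem IsAssMod.notMem {I P : Ideal R} (h : IsAssMod I P) {r : R} (hr : RegularMod I r) :
    r ∉ P := by
  obtain ⟨hP, a, ha⟩ := h
  intro hrP
  exact hP.ne_top ((Ideal.eq_top_iff_one P).2 ((ha 1).2 (by simpa using hr a ((ha r).1 hrP))))

theorem IsAssMod.le {I P : Ideal R} (h : IsAssMod I P) : I ≤ P := by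
  obtain ⟨hP, a, ha⟩ := h
  exact fun s hs => (ha s).2 (I.mul_mem_right _ hs)

theorem isAssMod_iff [IsNoetherianRing R] {I P : Ideal R} :
    IsAssMod I P ↔ P ∈ associatedPrimes R (R ⧸ I) := by
  rw [AssociatedPrimes.mem_iff, isAssociatedPrime_iff]
  refine and_congr_right fun _ => ?_
  constructor
  · rintro ⟨a, ha⟩
    refine ⟨Ideal.Quotient.mk I a, ?_⟩
    ext s
    rw [Submodule.mem_colon_singleton, Submodule.mem_bot, ha, ← Ideal.Quotient.eq_zero_iff_mem,
      map_mul]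
    rfl
  · rintro ⟨x, hx⟩
    obtain ⟨a, rfl⟩ := Ideal.Quotient.mk_surjective x
    refine ⟨a, fun s => ?_⟩
    rw [hx, Submodule.mem_colon_singleton, Submodule.mem_bot, ← Ideal.Quotient.eq_zero_iff_mem,
      map_mul]
    rfl

theorem finite_isAssMod [IsNoetherianRing R] (I : Ideal R) : {P | IsAssMod I P}.Finite := by
  have : {P | IsAssMod I P} = associatedPrimes R (R ⧸ I) := by
    ext P; exact isAssMod_iff
  rw [this]
  exact associatedPrimes.finite R (R ⧸ I)

theorem exists_isAssMod [IsNoetherianRing R] {I : Ideal R} {a : R} (ha : a ∉ I) :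
    ∃ P, IsAssMod I P ∧ ∀ s, s * a ∈ I → s ∈ P := by
  obtain ⟨P, hP, h⟩ := exists_le_isAssociatedPrime_of_isNoetherianRing R (Ideal.Quotient.mk I a)
    (by rwa [Ne, Ideal.Quotient.eq_zero_iff_mem])
  refine ⟨P, isAssMod_iff.2 hP, fun s hs => h ?_⟩
  rw [Submodule.mem_colon_singleton, Submodule.mem_bot]
  rw [← Ideal.Quotient.eq_zero_iff_mem, map_mul] at hs
  exact hs

theorem exists_isAssMod_of_not_regularMod [IsNoetherianRing R] {I : Ideal R} {r : R}
    (h : ¬ RegularMod I r) : ∃ P, IsAssMod I P ∧ r ∈ P := by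
  simp only [RegularMod, not_forall] at h
  obtain ⟨a, ha, haI⟩ := h
  obtain ⟨P, hP, hs⟩ := exists_isAssMod haI
  exact ⟨P, hP, hs r ha⟩

/-- Prime avoidance for the associated primes of a finite family of quotients. -/
theorem exists_regularMod_of_finite [IsNoetherianRing R] {ι : Type*} (s : Finset ι)
    (I : ι → Ideal R) (J : Ideal R) (h : ∀ i ∈ s, ∀ P, IsAssMod (I i) P → ¬ J ≤ P) :
    ∃ z ∈ J, ∀ i ∈ s, RegularMod (I i) z := by
  have hfin : (⋃ i ∈ s, {P | IsAssMod (I i) P}).Finite :=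
    s.finite_toSet.biUnion fun i _ => finite_isAssMod (I i)
  have hav := Ideal.subset_union_prime_finite (R := R) (f := fun P : Ideal R => P) hfin ⊥ ⊥
    (fun P hP _ _ => by
      obtain ⟨i, -, hi⟩ := Set.mem_iUnion₂.1 hP
      exact hi.1) (I := J)
  have hnot : ¬ ((J : Set R) ⊆ ⋃ P ∈ ⋃ i ∈ s, {P | IsAssMod (I i) P}, (P : Set R)) := by
    intro hsub
    obtain ⟨P, hP, hJP⟩ := hav.1 hsub
    obtain ⟨i, hi, hiP⟩ := Set.mem_iUnion₂.1 hP
    exact h i hi P hiP hJP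
  obtain ⟨z, hzJ, hz⟩ := Set.not_subset.1 hnot
  refine ⟨z, hzJ, fun i hi => ?_⟩
  by_contra hreg
  obtain ⟨P, hP, hzP⟩ := exists_isAssMod_of_not_regularMod hreg
  exact hz (Set.mem_iUnion₂.2 ⟨P, Set.mem_iUnion₂.2 ⟨i, hi, hP⟩, hzP⟩)

end RegularMod

section Depth

variable {T : Type*} [CommRing T] [IsLocalRing T]

/-- There is a regular sequence of length `n` on `T / I` inside the maximal ideal. -/
def DepthModGE : ℕ → Ideal T → Prop
  | 0, _ => True
  | n + 1, I => ∃ r ∈ maximalIdeal T, RegularMod I r ∧ DepthModGE n (I ⊔ Ideal.span {r})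

theorem IsAssMod.maximalIdeal_transfer {I : Ideal T} {r x : T} (hrm : r ∈ maximalIdeal T)
    (hr : RegularMod I r) (hx : RegularMod I x)
    (h : IsAssMod (I ⊔ Ideal.span {x}) (maximalIdeal T)) :
    IsAssMod (I ⊔ Ideal.span {r}) (maximalIdeal T) := by
  obtain ⟨hP, a, ha⟩ := h
  have ha1 : a ∉ I ⊔ Ideal.span {x} := fun h =>
    hP.ne_top ((Ideal.eq_top_iff_one _).2 ((ha 1).2 (by simpa using h)))
  obtain ⟨b, hb⟩ := mem_sup_span_singleton.1 ((ha r).1 hrm)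
  refine ⟨hP, b, fun s => ⟨fun hs => ?_, fun hs => ?_⟩⟩
  · obtain ⟨c, hc⟩ := mem_sup_span_singleton.1 ((ha s).1 hs)
    refine mem_sup_span_singleton.2 ⟨c, hx _ ?_⟩
    have : x * (s * b - r * c) = r * (s * a - x * c) - s * (r * a - x * b) := by ring
    rw [this]
    exact I.sub_mem (I.mul_mem_left _ hc) (I.mul_mem_left _ hb)
  · by_contra hsm
    have hu : IsUnit s := by
      by_contra hu
      exact hsm ((mem_maximalIdeal s).2 hu)
    obtain ⟨u, rfl⟩ := hu
    have hb' : b ∈ I ⊔ Ideal.span {r} := by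
      have := Ideal.mul_mem_left _ (↑u⁻¹ : T) hs
      rwa [← mul_assoc, Units.inv_mul, one_mul] at this
    obtain ⟨c, hc⟩ := mem_sup_span_singleton.1 hb'
    refine ha1 (mem_sup_span_singleton.2 ⟨c, hr _ ?_⟩)
    have : r * (a - x * c) = (r * a - x * b) + x * (b - r * c) := by ring
    rw [this]
    exact I.add_mem hb (I.mul_mem_left _ hc)

theorem DepthModGE.not_isAssMod {n : ℕ} {I : Ideal T} (h : DepthModGE (n + 1) I) :
    ¬ IsAssMod I (maximalIdeal T) := by
  obtain ⟨r, hrm, hr, -⟩ := h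
  exact fun h => h.notMem hr hrm

theorem not_maximalIdeal_le_of_isAssMod {I P : Ideal T} (h : ¬ IsAssMod I (maximalIdeal T))
    (hP : IsAssMod I P) : ¬ maximalIdeal T ≤ P := by
  intro hle
  have : P = maximalIdeal T := le_antisymm (le_maximalIdeal hP.1.ne_top) hle
  exact h (this ▸ hP)

variable [IsNoetherianRing T]

theorem DepthModGE.quotient {n : ℕ} {I : Ideal T} (h : DepthModGE (n + 1) I) {x : T}
    (hxm : x ∈ maximalIdeal T) (hx : RegularMod I x) : DepthModGE n (I ⊔ Ideal.span {x}) := by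
  induction n generalizing I x with
  | zero => trivial
  | succ n ih =>
    have hI := h.not_isAssMod
    obtain ⟨r, hrm, hr, hd⟩ := h
    have hIr := hd.not_isAssMod
    have hIx : ¬ IsAssMod (I ⊔ Ideal.span {x}) (maximalIdeal T) := fun h =>
      hIr (h.maximalIdeal_transfer hrm hr hx)
    obtain ⟨z, hzm, hz⟩ := exists_regularMod_of_finite (Finset.univ : Finset (Fin 3))
      ![I, I ⊔ Ideal.span {r}, I ⊔ Ideal.span {x}] (maximalIdeal T) (by
        intro i _ P hP
        fin_cases i
        · exact not_maximalIdeal_le_of_isAssMod hI hP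
        · exact not_maximalIdeal_le_of_isAssMod hIr hP
        · exact not_maximalIdeal_le_of_isAssMod hIx hP)
    have hz0 : RegularMod I z := hz 0 (Finset.mem_univ _)
    have hz1 : RegularMod (I ⊔ Ideal.span {r}) z := hz 1 (Finset.mem_univ _)
    have hz2 : RegularMod (I ⊔ Ideal.span {x}) z := hz 2 (Finset.mem_univ _)
    have h1 : DepthModGE n (I ⊔ Ideal.span {r} ⊔ Ideal.span {z}) := ih hd hzm hz1
    rw [sup_right_comm] at h1
    have h2 : DepthModGE (n + 1) (I ⊔ Ideal.span {z}) := ⟨r, hrm, hr.exchange hz1, h1⟩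
    have h3 := ih h2 hxm (hx.exchange hz2)
    rw [sup_right_comm] at h3
    exact ⟨z, hzm, hz2, h3⟩

theorem DepthModGE.le_ringKrullDim {n : ℕ} {I P : Ideal T} (h : DepthModGE n I)
    (hP : IsAssMod I P) : (n : WithBot ℕ∞) ≤ ringKrullDim (T ⧸ P) := by
  induction n generalizing I P with
  | zero =>
    have := hP.1
    simpa using ringKrullDim_nonneg_of_nontrivial (R := T ⧸ P)
  | succ n ih =>
    obtain ⟨r, hrm, hr, hd⟩ := h
    have hrP := hP.notMem hr
    obtain ⟨hPp, a, ha⟩ := hP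
    let N : Ideal T := I.colon (P : Set T)
    have hmem : ∀ b, b ∈ N ↔ ∀ s ∈ P, s * b ∈ I := fun b => by
      simp only [N, Submodule.mem_colon, smul_eq_mul, mul_comm b]; rfl
    have hNot : ¬ N ≤ I ⊔ Ideal.span {r} := by
      intro hle
      have hN : N ≤ I ⊔ (Ideal.span {r} : Ideal T) • N := by
        intro b hb
        obtain ⟨c, hc⟩ := mem_sup_span_singleton.1 (hle hb)
        have hcN : c ∈ N := (hmem c).2 fun s hs => hr _ (by
          have h1 : r * (s * c) = s * b - s * (b - r * c) := by ring
          rw [h1]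
          exact I.sub_mem ((hmem b).1 hb s hs) (I.mul_mem_left _ hc))
        refine Submodule.mem_sup.2 ⟨_, hc, r * c, ?_, by ring⟩
        exact Submodule.smul_mem_smul (Ideal.mem_span_singleton_self r) hcN
      have := Submodule.le_of_le_smul_of_le_jacobson_bot (IsNoetherian.noetherian N)
        (by
          rw [IsLocalRing.jacobson_eq_maximalIdeal _ bot_ne_top]
          exact (Ideal.span_singleton_le_iff_mem _).2 hrm) hN
      have haI : a ∈ I := this ((hmem a).2 fun s hs => (ha s).1 hs)
      exact hPp.ne_top ((Ideal.eq_top_iff_one _).2 ((ha 1).2 (by simpa using haI)))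
    obtain ⟨b, hbN, hb⟩ := SetLike.not_le_iff_exists.1 hNot
    obtain ⟨Q, hQ, hQs⟩ := exists_isAssMod hb
    have hPQ : P ≤ Q := fun s hs => hQs s (Ideal.mem_sup_left ((hmem b).1 hbN s hs))
    have hrQ : r ∈ Q := hQ.le (Ideal.mem_sup_right (Ideal.mem_span_singleton_self r))
    have h1 := ih hd hQ
    have h2 := ringKrullDim_succ_le_of_surjective (Ideal.Quotient.factor hPQ)
      (Ideal.Quotient.factor_surjective hPQ) (r := Ideal.Quotient.mk P r)
      (mem_nonZeroDivisors_of_ne_zero (by rwa [Ne, Ideal.Quotient.eq_zero_iff_mem]))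
      (by rw [Ideal.Quotient.factor_mk, Ideal.Quotient.eq_zero_iff_mem]; exact hrQ)
    calc ((n + 1 : ℕ) : WithBot ℕ∞) = n + 1 := by norm_cast
      _ ≤ ringKrullDim (T ⧸ Q) + 1 := by gcongr
      _ ≤ _ := h2

end Depth

section SystemOfParameters

variable {T : Type*} [CommRing T] [IsLocalRing T]

theorem DepthModGE.of_isWeaklyRegular {rs : List T} (hm : ∀ x ∈ rs, x ∈ maximalIdeal T)
    (h : RingTheory.Sequence.IsWeaklyRegular T rs) : DepthModGE rs.length (⊥ : Ideal T) := by
  suffices H : ∀ k i, i + k = rs.length → DepthModGE k (Ideal.ofList (rs.take i)) by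
    simpa using H rs.length 0 (by simp)
  intro k
  induction k with
  | zero => intro i _; trivial
  | succ k ih =>
    intro i hi
    have hlt : i < rs.length := by omega
    refine ⟨rs[i], hm _ (List.getElem_mem hlt), ?_, ?_⟩
    · have h1 := (isSMulRegular_quotient_iff_mem_of_smul_mem _ _).1 (h.regular_mod_prev i hlt)
      intro a ha
      simpa using h1 a (by simpa using ha)
    · have h2 := ih (i + 1) (by omega)
      rwa [List.take_succ_eq_append_getElem hlt, Ideal.ofList_append,
        Ideal.ofList_singleton] at h2

variable [IsNoetherianRing T]

theorem ringKrullDim_quotient_le_of_radical {ι : Type*} [Fintype ι] [DecidableEq ι] {x : ι → T}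
    (hx : (Ideal.span (Set.range x)).radical = maximalIdeal T) {P : Ideal T} (hP : P.IsPrime)
    (s : Finset ι) (hs : ∀ i ∈ s, x i ∈ P) :
    ringKrullDim (T ⧸ P) ≤ ((sᶜ).card : WithBot ℕ∞) := by
  classical
  have hxm : ∀ i, x i ∈ maximalIdeal T := fun i => by
    rw [← hx]; exact Ideal.le_radical (Ideal.subset_span ⟨i, rfl⟩)
  have hle : P ≤ maximalIdeal T := le_maximalIdeal hP.ne_top
  have : IsLocalRing (T ⧸ P) :=
    IsLocalRing.of_surjective' (Ideal.Quotient.mk P) Ideal.Quotient.mk_surjective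
  let t : Finset (T ⧸ P) := (sᶜ).image fun i => Ideal.Quotient.mk P (x i)
  have ht : (t : Set (T ⧸ P)) ⊆ Ring.jacobson (T ⧸ P) := by
    rw [IsLocalRing.ringJacobson_eq_maximalIdeal]
    intro z hz
    obtain ⟨i, -, rfl⟩ := Finset.mem_image.1 hz
    rw [SetLike.mem_coe, mem_maximalIdeal, mem_nonunits_iff]
    intro hu
    have hle1 : Ideal.Quotient.mk P (x i) ∈ (maximalIdeal T).map (Ideal.Quotient.mk P) :=
      Ideal.mem_map_of_mem _ (hxm i)
    have htop := Ideal.eq_top_of_isUnit_mem _ hle1 hu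
    have h1 : (1 : T) ∈ ((maximalIdeal T).map (Ideal.Quotient.mk P)).comap
      (Ideal.Quotient.mk P) := by rw [htop]; trivial
    rw [Ideal.comap_map_of_surjective _ Ideal.Quotient.mk_surjective, ← RingHom.ker_eq_comap_bot,
      Ideal.mk_ker, sup_eq_left.2 hle] at h1
    exact (Ideal.ne_top_iff_one _).1 (maximalIdeal.isMaximal T).ne_top h1
  have hdim := ringKrullDim_le_ringKrullDim_quotient_add_card t ht
  have h0 : Ring.KrullDimLE 0 ((T ⧸ P) ⧸ Ideal.span (t : Set (T ⧸ P))) := by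
    rw [Ring.krullDimLE_zero_iff]
    intro J hJ
    let f : T →+* ((T ⧸ P) ⧸ Ideal.span (t : Set (T ⧸ P))) :=
      (Ideal.Quotient.mk _).comp (Ideal.Quotient.mk P)
    have hf : Function.Surjective f :=
      Ideal.Quotient.mk_surjective.comp Ideal.Quotient.mk_surjective
    have hJp : (J.comap f).IsPrime := Ideal.comap_isPrime f J
    have hmJ : J.comap f = maximalIdeal T := by
      refine le_antisymm (le_maximalIdeal hJp.ne_top) ?_
      rw [← hx, hJp.radical_le_iff, Ideal.span_le]
      rintro _ ⟨i, rfl⟩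
      have hi : f (x i) = 0 := by
        by_cases his : i ∈ s
        · simp [f, Ideal.Quotient.eq_zero_iff_mem.2 (hs i his)]
        · refine Ideal.Quotient.eq_zero_iff_mem.2 (Ideal.subset_span ?_)
          exact Finset.mem_coe.2 (Finset.mem_image.2 ⟨i, by simpa using his, rfl⟩)
      rw [SetLike.mem_coe, Ideal.mem_comap, hi]
      exact J.zero_mem
    rw [← Ideal.map_comap_of_surjective f hf J, hmJ]
    refine (Ideal.map_eq_top_or_isMaximal_of_surjective f hf
      (maximalIdeal.isMaximal T)).resolve_left fun htop => hJ.ne_top ?_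
    rw [← Ideal.map_comap_of_surjective f hf J, hmJ, htop]
  have h0' : ringKrullDim ((T ⧸ P) ⧸ Ideal.span (t : Set (T ⧸ P))) ≤ 0 := by
    simpa using Ring.krullDimLE_iff.1 h0
  calc ringKrullDim (T ⧸ P) ≤ 0 + (t.card : WithBot ℕ∞) := hdim.trans (by gcongr)
    _ ≤ ((sᶜ).card : WithBot ℕ∞) := by
      rw [zero_add]
      exact_mod_cast Finset.card_image_le

theorem regularMod_of_depthModGE {ι : Type*} [Fintype ι] [DecidableEq ι] {x : ι → T}
    (hx : (Ideal.span (Set.range x)).radical = maximalIdeal T)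
    {s : Finset ι} (h : DepthModGE (sᶜ).card (Ideal.span (x '' s))) {i : ι} (hi : i ∉ s) :
    RegularMod (Ideal.span (x '' s)) (x i) := by
  by_contra hreg
  obtain ⟨P, hP, hiP⟩ := exists_isAssMod_of_not_regularMod hreg
  have h1 := h.le_ringKrullDim hP
  have h2 := ringKrullDim_quotient_le_of_radical hx hP.1 (insert i s) (by
    intro j hj
    rcases Finset.mem_insert.1 hj with rfl | hj
    · exact hiP
    · exact hP.le (Ideal.subset_span ⟨j, hj, rfl⟩))
  have h3 : ((sᶜ).card : WithBot ℕ∞) ≤ (((insert i s)ᶜ).card : WithBot ℕ∞) := h1.trans h2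
  have h4 : (sᶜ).card ≤ ((insert i s)ᶜ).card := by exact_mod_cast h3
  rw [Finset.card_compl, Finset.card_compl, Finset.card_insert_of_notMem hi] at h4
  have := Finset.card_lt_univ_of_notMem hi
  omega

theorem depthModGE_span_image {ι : Type*} [Fintype ι] [DecidableEq ι] {x : ι → T}
    (hx : (Ideal.span (Set.range x)).radical = maximalIdeal T)
    (h : DepthModGE (Fintype.card ι) (⊥ : Ideal T)) (s : Finset ι) :
    DepthModGE (sᶜ).card (Ideal.span (x '' s)) := by
  induction s using Finset.induction_on with
  | empty => simpa using h
  | insert i s hi ih =>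
    have hreg := regularMod_of_depthModGE hx ih hi
    have hxm : x i ∈ maximalIdeal T := by
      rw [← hx]; exact Ideal.le_radical (Ideal.subset_span ⟨i, rfl⟩)
    have hc : (sᶜ).card = ((insert i s)ᶜ).card + 1 := by
      rw [Finset.card_compl, Finset.card_compl, Finset.card_insert_of_notMem hi]
      have := Finset.card_lt_univ_of_notMem hi
      omega
    rw [hc] at ih
    have := ih.quotient hxm hreg
    rwa [← Ideal.span_union, Set.union_comm, Set.singleton_union, ← Set.image_insert_eq,
      ← Finset.coe_insert] at this

/-- In a Cohen–Macaulay local ring, each member of a system of parameters is regular modulo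
the others. -/
theorem IsCohenMacaulayLocal.regularMod (hCM : IsCohenMacaulayLocal T) {n : ℕ}
    (hn : (n : WithBot ℕ∞) = ringKrullDim T) {x : Fin n → T}
    (hx : (Ideal.span (Set.range x)).radical = maximalIdeal T) (i : Fin n) :
    RegularMod (Ideal.span (x '' {j | j ≠ i})) (x i) := by
  obtain ⟨rs, hm, hreg, hlen⟩ := hCM
  have hd := DepthModGE.of_isWeaklyRegular hm hreg.toIsWeaklyRegular
  have hl : rs.length = n := by
    have : (rs.length : WithBot ℕ∞) = (n : WithBot ℕ∞) := hlen.trans hn.symm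
    exact_mod_cast this
  rw [hl] at hd
  have h1 := depthModGE_span_image hx (by simpa using hd) (Finset.univ.erase i)
  have h2 := regularMod_of_depthModGE hx h1 (i := i) (by simp)
  have : ((Finset.univ.erase i : Finset (Fin n)) : Set (Fin n)) = {j | j ≠ i} := by
    ext j; simp
  rwa [this] at h2

theorem radical_span_pow {T : Type*} [CommRing T] [IsLocalRing T] {n : ℕ} {x : Fin n → T}
    (hx : (Ideal.span (Set.range x)).radical = maximalIdeal T) (e : Fin n → ℕ)
    (he : ∀ i, 0 < e i) :
    (Ideal.span (Set.range fun i => x i ^ e i)).radical = maximalIdeal T := by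
  rw [← hx]
  apply le_antisymm
  · refine Ideal.radical_mono (Ideal.span_le.2 ?_)
    rintro _ ⟨i, rfl⟩
    exact Ideal.pow_mem_of_mem _ (Ideal.subset_span (Set.mem_range_self i)) _ (he i)
  · rw [Ideal.radical_le_radical_iff, Ideal.span_le]
    rintro _ ⟨i, rfl⟩
    exact Ideal.mem_radical_iff.2 ⟨e i, Ideal.subset_span (Set.mem_range_self i)⟩

theorem span_range_eq_sup {R : Type*} [CommRing R] {n : ℕ} (x : Fin n → R) (i : Fin n) :
    Ideal.span (Set.range x) = Ideal.span (x '' {j | j ≠ i}) ⊔ Ideal.span {x i} := by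
  rw [← Ideal.span_union, ← Set.image_singleton, ← Set.image_union, ← Set.image_univ]
  congr 2
  ext j
  simp [em]

theorem mem_span_pow_of_mul_pow_mem {T : Type*} [CommRing T] {n : ℕ} {x : Fin n → T}
    (hreg : ∀ e : Fin n → ℕ, (∀ i, 0 < e i) → ∀ i,
      RegularMod (Ideal.span ((fun j => x j ^ e j) '' {j | j ≠ i})) (x i))
    {e : Fin n → ℕ} (he : ∀ i, 0 < e i) (i : Fin n) (k : ℕ) {a : T}
    (ha : a * x i ^ k ∈ Ideal.span (Set.range fun j => x j ^ (if j = i then e j + k else e j))) :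
    a ∈ Ideal.span (Set.range fun j => x j ^ e j) := by
  rw [span_range_eq_sup _ i] at ha ⊢
  have himg : (fun j => x j ^ (if j = i then e j + k else e j)) '' {j | j ≠ i} =
      (fun j => x j ^ e j) '' {j | j ≠ i} := by
    apply Set.image_congr
    intro j hj
    have : j ≠ i := hj
    simp [this]
  rw [himg] at ha
  simp only [if_true] at ha
  obtain ⟨b, hb⟩ := mem_sup_span_singleton.1 ha
  refine mem_sup_span_singleton.2 ⟨b, ((hreg e he i).pow k) _ ?_⟩
  convert hb using 1
  ring

theorem mem_span_pow_of_mul_prod_mem {T : Type*} [CommRing T] {n : ℕ} {x : Fin n → T}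
    (hreg : ∀ e : Fin n → ℕ, (∀ i, 0 < e i) → ∀ i,
      RegularMod (Ideal.span ((fun j => x j ^ e j) '' {j | j ≠ i})) (x i))
    {q : ℕ} (hq : 0 < q) (k : ℕ) {a : T}
    (ha : a * ∏ i, x i ^ k ∈ Ideal.span (Set.range fun j => x j ^ (q + k))) :
    a ∈ Ideal.span (Set.range fun j => x j ^ q) := by
  classical
  suffices H : ∀ s : Finset (Fin n), ∀ a : T,
      a * ∏ i ∈ s, x i ^ k ∈ Ideal.span (Set.range fun j => x j ^ (if j ∈ s then q + k else q)) →
      a ∈ Ideal.span (Set.range fun j => x j ^ q) from H Finset.univ a (by simpa using ha)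
  intro s
  induction s using Finset.induction_on with
  | empty => intro a h; simpa using h
  | insert i s hi ih =>
    intro a h
    rw [Finset.prod_insert hi, mul_comm (x i ^ k), ← mul_assoc] at h
    refine ih _ (mem_span_pow_of_mul_pow_mem hreg (e := fun j => if j ∈ s then q + k else q)
      (fun j => by split_ifs <;> omega) i k ?_)
    have hfun : (fun j => x j ^ (if j = i then (if j ∈ s then q + k else q) + k
        else if j ∈ s then q + k else q)) =
        fun j => x j ^ (if j ∈ insert i s then q + k else q) := by
      funext j
      by_cases hj : j = i
      · subst hj; simp [hi]
      · simp [hj]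
    rw [hfun]
    exact h

theorem IsCohenMacaulayLocal.mem_span_pow (hCM : IsCohenMacaulayLocal T) {n : ℕ}
    (hn : (n : WithBot ℕ∞) = ringKrullDim T) {x : Fin n → T}
    (hx : (Ideal.span (Set.range x)).radical = maximalIdeal T)
    {q : ℕ} (hq : 0 < q) (k : ℕ) {a : T}
    (ha : a * ∏ i, x i ^ k ∈ Ideal.span (Set.range fun j => x j ^ (q + k))) :
    a ∈ Ideal.span (Set.range fun j => x j ^ q) := by
  refine mem_span_pow_of_mul_prod_mem (fun e he i => ?_) hq k ha
  have h := hCM.regularMod hn (radical_span_pow hx e he) i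
  obtain ⟨m, hm⟩ := Nat.exists_eq_add_of_lt (he i)
  rw [hm, zero_add, pow_succ'] at h
  exact h.of_mul_left

end SystemOfParameters

section Duality

variable {B : Type*} [CommRing B] [IsLocalRing B]

theorem length_span_singleton_le_one {s : B} (hs : ∀ m ∈ maximalIdeal B, m * s = 0) :
    Module.length B (Ideal.span {s} : Ideal B) ≤ 1 := by
  have hsimple : IsSimpleModule B (B ⧸ maximalIdeal B) :=
    isSimpleModule_iff_isCoatom.2 (maximalIdeal.isMaximal B).out
  rw [← Module.length_eq_one_iff.2 hsimple]
  let f : B →ₗ[B] (Ideal.span {s} : Ideal B) :=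
    (LinearMap.toSpanSingleton B B s).codRestrict _ fun r =>
      Ideal.mul_mem_left _ r (Ideal.mem_span_singleton_self s)
  have hf : maximalIdeal B ≤ LinearMap.ker f := fun m hm => by
    rw [LinearMap.mem_ker]
    exact Subtype.ext (hs m hm)
  refine Module.length_le_of_surjective ((maximalIdeal B).liftQ f hf) ?_
  rintro ⟨b, hb⟩
  obtain ⟨r, rfl⟩ := Ideal.mem_span_singleton'.1 hb
  exact ⟨Submodule.Quotient.mk r, Subtype.ext rfl⟩

variable [IsArtinianRing B]

theorem length_annihilator_add_length_le {s : B} (hs : ∀ m ∈ maximalIdeal B, m * s = 0)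
    (hsoc : ∀ b : B, (∀ m ∈ maximalIdeal B, m * b = 0) → b ∈ Ideal.span {s})
    {I I' : Ideal B} (h : I ≤ I') :
    Module.length B I.annihilator + Module.length B I ≤
      Module.length B I'.annihilator + Module.length B I' := by
  induction I using WellFoundedGT.induction with
  | _ I ih =>
  rcases h.eq_or_lt with rfl | hlt
  · exact le_rfl
  obtain ⟨N, hN⟩ : ∃ N, maximalIdeal B ^ N ≤ I := by
    obtain ⟨N, hN⟩ := IsArtinianRing.isNilpotent_jacobson_bot (R := B)
    rw [IsLocalRing.jacobson_eq_maximalIdeal _ bot_ne_top] at hN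
    exact ⟨N, by rw [hN]; exact bot_le⟩
  obtain ⟨z, hz, hzI, hmz⟩ : ∃ z ∈ I', z ∉ I ∧ ∀ m ∈ maximalIdeal B, m * z ∈ I := by
    have hex : ∃ n, maximalIdeal B ^ n * I' ≤ I := ⟨N, (Ideal.mul_le_left).trans hN⟩
    classical
    have hn := Nat.find_spec hex
    have hn0 : Nat.find hex ≠ 0 := by
      intro h0
      rw [h0, pow_zero, one_mul] at hn
      exact hlt.not_ge hn
    obtain ⟨k, hk⟩ := Nat.exists_eq_succ_of_ne_zero hn0
    have hlt' := Nat.find_min hex (m := k) (by omega)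
    obtain ⟨z, hz, hzI⟩ := SetLike.not_le_iff_exists.1 hlt'
    refine ⟨z, Ideal.mul_le_right hz, hzI, fun m hm => hn ?_⟩
    rw [hk, pow_succ', mul_assoc]
    exact Ideal.mul_mem_mul hm hz
  have hI1 : I < I ⊔ Ideal.span {z} := left_lt_sup.2 fun h =>
    hzI (h (Ideal.mem_span_singleton_self z))
  have hle1 : I ⊔ Ideal.span {z} ≤ I' := sup_le h ((Ideal.span_singleton_le_iff_mem _).2 hz)
  refine le_trans ?_ (ih _ hI1 hle1)
  let φ : I.annihilator →ₗ[B] B := (LinearMap.lsmul B B z).comp I.annihilator.subtype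
  have hφ : ∀ a, φ a = z * (a : B) := fun a => rfl
  have h1 : Module.length B I.annihilator =
      Module.length B (LinearMap.ker φ) + Module.length B (LinearMap.range φ) :=
    Module.length_eq_add_of_exact (LinearMap.ker φ).subtype φ.rangeRestrict
      (Submodule.subtype_injective _) φ.surjective_rangeRestrict
      (by
        rw [LinearMap.exact_iff, LinearMap.ker_rangeRestrict, Submodule.range_subtype])
  have h2 : Module.length B (LinearMap.range φ) ≤ 1 := by
    refine le_trans ?_ (length_span_singleton_le_one hs)
    have hle : LinearMap.range φ ≤ (Ideal.span {s} : Ideal B) := by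
      rintro _ ⟨a, rfl⟩
      refine hsoc _ fun m hm => ?_
      have := Submodule.mem_annihilator.1 a.2 _ (hmz m hm)
      rw [hφ, ← mul_assoc, mul_comm]
      exact this
    exact Module.length_le_of_injective (Submodule.inclusion hle) (Submodule.inclusion_injective hle)
  have h3 : Module.length B (LinearMap.ker φ) ≤
      Module.length B (I ⊔ Ideal.span {z}).annihilator := by
    have hmem : ∀ a : LinearMap.ker φ, ((a : I.annihilator) : B) ∈
        (I ⊔ Ideal.span {z}).annihilator := by
      intro a
      rw [Submodule.mem_annihilator]
      intro w hw
      obtain ⟨i, hi, w', hw', rfl⟩ := Submodule.mem_sup.1 hw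
      obtain ⟨r, rfl⟩ := Ideal.mem_span_singleton'.1 hw'
      have h4 := Submodule.mem_annihilator.1 (a : I.annihilator).2 _ hi
      have h5 : z * ((a : I.annihilator) : B) = 0 := a.2
      rw [smul_add, h4, zero_add, smul_eq_mul]
      rw [mul_left_comm, mul_comm _ z, h5, mul_zero]
    let ψ : LinearMap.ker φ →ₗ[B] (I ⊔ Ideal.span {z}).annihilator :=
      { toFun := fun a => ⟨_, hmem a⟩
        map_add' := fun _ _ => rfl
        map_smul' := fun _ _ => rfl }
    refine Module.length_le_of_injective ψ fun a b hab => Subtype.ext (Subtype.ext ?_)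
    exact congrArg (fun w : (I ⊔ Ideal.span {z}).annihilator => (w : B)) hab
  have h4 : Module.length B I + 1 ≤ Module.length B (I ⊔ Ideal.span {z} : Ideal B) := by
    rw [Module.length_submodule, Module.length_submodule]
    exact Order.add_one_le_of_lt (Submodule.height_strictMono hI1)
  calc Module.length B I.annihilator + Module.length B I
      ≤ (Module.length B (I ⊔ Ideal.span {z}).annihilator + 1) + Module.length B I := by
        rw [h1]; gcongr
    _ = Module.length B (I ⊔ Ideal.span {z}).annihilator + (Module.length B I + 1) := by
        rw [add_assoc, add_comm 1]
    _ ≤ _ := by gcongr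

/-- In an Artinian local ring with simple socle every ideal is the annihilator of its
annihilator. -/
theorem exists_annihilator_mul_ne_zero {s : B} (hs : ∀ m ∈ maximalIdeal B, m * s = 0)
    (hsoc : ∀ b : B, (∀ m ∈ maximalIdeal B, m * b = 0) → b ∈ Ideal.span {s})
    {I : Ideal B} {x : B} (hx : x ∉ I) : ∃ u, (∀ i ∈ I, u * i = 0) ∧ u * x ≠ 0 := by
  by_contra! hcon
  have hlt : I < I ⊔ Ideal.span {x} := left_lt_sup.2 fun h =>
    hx (h (Ideal.mem_span_singleton_self x))
  have hann : I.annihilator = (I ⊔ Ideal.span {x}).annihilator := by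
    refine le_antisymm (fun u hu => ?_) (Submodule.annihilator_mono le_sup_left)
    rw [Submodule.mem_annihilator] at hu ⊢
    intro w hw
    obtain ⟨i, hi, w', hw', rfl⟩ := Submodule.mem_sup.1 hw
    obtain ⟨r, rfl⟩ := Ideal.mem_span_singleton'.1 hw'
    rw [smul_add, hu i hi, zero_add, smul_eq_mul, mul_left_comm, hcon u hu, mul_zero]
  have h1 := length_annihilator_add_length_le hs hsoc (bot_le (a := I))
  have h2 := length_annihilator_add_length_le hs hsoc (le_top (a := I ⊔ Ideal.span {x}))
  have hb : (⊥ : Ideal B).annihilator = ⊤ := Submodule.annihilator_bot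
  have ht : (⊤ : Ideal B).annihilator = ⊥ := by
    rw [eq_bot_iff]
    intro u hu
    simpa using Submodule.mem_annihilator.1 hu 1 trivial
  rw [hb, Module.length_bot, add_zero, Module.length_top] at h1
  rw [ht, Module.length_bot, zero_add, Module.length_top, ← hann] at h2
  have h3 : Module.length B I < Module.length B (I ⊔ Ideal.span {x} : Ideal B) := by
    rw [Module.length_submodule, Module.length_submodule]
    exact Submodule.height_strictMono hlt
  have hfin : Module.length B I.annihilator ≠ ⊤ := Module.length_ne_top
  have h4 := (ENat.add_lt_add_iff_left hfin).2 h3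
  exact absurd (h1.trans_lt (h4.trans_le h2)) (lt_irrefl _)

end Duality

theorem exists_annihilator_mul_eq {B : Type*} [CommRing B] [IsLocalRing B] [IsArtinianRing B]
    {s : B} (hs : ∀ m ∈ maximalIdeal B, m * s = 0)
    (hsoc : ∀ b : B, (∀ m ∈ maximalIdeal B, m * b = 0) → b ∈ Ideal.span {s})
    {I : Ideal B} {x : B} (hx : x ∉ I) : ∃ u, (∀ i ∈ I, u * i = 0) ∧ u * x = s := by
  obtain ⟨K, ⟨hIK, hxK⟩, hmax⟩ := set_has_maximal_iff_noetherian.2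
    (inferInstance : IsNoetherian B B) {K : Ideal B | I ≤ K ∧ x ∉ K} ⟨I, le_rfl, hx⟩
  obtain ⟨u, hu, hux⟩ := exists_annihilator_mul_ne_zero hs hsoc hxK
  have hmx : ∀ m ∈ maximalIdeal B, m * x ∈ K := by
    intro m hm
    by_contra hmK
    have hlt : K < K ⊔ Ideal.span {m * x} := left_lt_sup.2 fun h =>
      hmK (h (Ideal.mem_span_singleton_self _))
    have hxmem : x ∈ K ⊔ Ideal.span {m * x} := by
      by_contra hx'
      exact hmax _ ⟨hIK.trans le_sup_left, hx'⟩ hlt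
    obtain ⟨b, hb⟩ := mem_sup_span_singleton.1 hxmem
    have hun : IsUnit (1 - m * b) := by
      by_contra h
      have h1 : (1 - m * b) + m * b ∈ maximalIdeal B :=
        Ideal.add_mem _ ((mem_maximalIdeal _).2 h) (Ideal.mul_mem_right _ _ hm)
      rw [sub_add_cancel] at h1
      exact (Ideal.ne_top_iff_one _).1 (maximalIdeal.isMaximal B).ne_top h1
    obtain ⟨v, hv⟩ := hun
    apply hxK
    have h2 : x = ↑v⁻¹ * (x - m * x * b) := by
      have : x - m * x * b = v * x := by rw [hv]; ring
      rw [this, ← mul_assoc, Units.inv_mul, one_mul]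
    rw [h2]
    exact Ideal.mul_mem_left K _ hb
  obtain ⟨r, hr⟩ := Ideal.mem_span_singleton'.1 (hsoc (u * x) fun m hm => by
    rw [mul_left_comm]; exact hu _ (hmx m hm))
  have hrun : IsUnit r := by
    by_contra h
    exact hux (by rw [← hr]; exact hs r ((mem_maximalIdeal _).2 h))
  obtain ⟨v, rfl⟩ := hrun
  refine ⟨↑v⁻¹ * u, fun i hi => by rw [mul_assoc, hu i (hIK hi), mul_zero], ?_⟩
  rw [mul_assoc, ← hr, ← mul_assoc, Units.inv_mul, one_mul]

section PowerSeriesIdeals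

open PowerSeries

variable {T : Type*} [CommRing T]

/-- The power series whose first `n` coefficients lie in `K`. -/
def coeffIdeal (K : Ideal T) (n : ℕ) : Ideal T⟦X⟧ where
  carrier := {f | ∀ i < n, coeff i f ∈ K}
  zero_mem' := fun i _ => by simp
  add_mem' := fun hf hg i hi => by
    rw [map_add]; exact K.add_mem (hf i hi) (hg i hi)
  smul_mem' := fun c f hf i hi => by
    rw [smul_eq_mul, coeff_mul]
    refine K.sum_mem fun ij hij => K.mul_mem_left _ (hf _ ?_)
    have := Finset.HasAntidiagonal.mem_antidiagonal.1 hij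
    omega

theorem mem_coeffIdeal {K : Ideal T} {n : ℕ} {f : T⟦X⟧} :
    f ∈ coeffIdeal K n ↔ ∀ i < n, coeff i f ∈ K := Iff.rfl

theorem X_pow_mul_mem_coeffIdeal {K : Ideal T} {n m : ℕ} (h : n ≤ m) (g : T⟦X⟧) :
    X ^ m * g ∈ coeffIdeal K n := fun i hi => by
  rw [coeff_X_pow_mul', if_neg (by omega)]; exact K.zero_mem

theorem C_mul_mem_coeffIdeal {K : Ideal T} {n : ℕ} {a : T} (ha : a ∈ K) (g : T⟦X⟧) :
    C a * g ∈ coeffIdeal K n := fun i _ => by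
  rw [coeff_C_mul]; exact K.mul_mem_right _ ha

theorem eq_X_pow_mul_add_sum (n : ℕ) (f : T⟦X⟧) :
    ∃ g, f = X ^ n * g + ∑ i ∈ Finset.range n, C (coeff i f) * X ^ i := by
  refine ⟨mk fun i => coeff (i + n) f, ?_⟩
  ext k
  rw [map_add, coeff_X_pow_mul', map_sum]
  simp only [coeff_C_mul, coeff_X_pow, mul_ite, mul_one, mul_zero, coeff_mk]
  rw [Finset.sum_ite_eq]
  split_ifs with h1 h2 h2
  · rw [Finset.mem_range] at h2; omega
  · rw [Nat.sub_add_cancel h1, add_zero]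
  · rw [zero_add]
  · rw [Finset.mem_range] at h2; omega

theorem coeffIdeal_le {K : Ideal T} {n : ℕ} {J : Ideal T⟦X⟧} (hX : X ^ n ∈ J)
    (hC : ∀ a ∈ K, ∀ i < n, C a * X ^ i ∈ J) : coeffIdeal K n ≤ J := by
  intro f hf
  obtain ⟨g, hg⟩ := eq_X_pow_mul_add_sum n f
  rw [hg]
  refine J.add_mem (J.mul_mem_right _ hX) (J.sum_mem fun i hi => ?_)
  exact hC _ (hf i (Finset.mem_range.1 hi)) i (Finset.mem_range.1 hi)

section Frobenius

variable (p : ℕ) [Fact p.Prime] [CharP T p]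

instance powerSeriesCharP : CharP T⟦X⟧ p :=
  charP_of_injective_ringHom (f := (C : T →+* T⟦X⟧)) C_injective p

theorem pow_mem_span_pow {n : ℕ} (x : Fin n → T) (m e : ℕ) {a : T}
    (ha : a ∈ Ideal.span (Set.range fun j => x j ^ m)) :
    a ^ p ^ e ∈ Ideal.span (Set.range fun j => x j ^ (m * p ^ e)) := by
  have hle : Ideal.span (Set.range fun j => x j ^ m) ≤
      (Ideal.span (Set.range fun j => x j ^ (m * p ^ e))).comap (iterateFrobenius T p e) := by
    rw [Ideal.span_le]
    rintro _ ⟨j, rfl⟩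
    rw [SetLike.mem_coe, Ideal.mem_comap, iterateFrobenius_def, ← pow_mul]
    exact Ideal.subset_span ⟨j, rfl⟩
  have := hle ha
  rwa [Ideal.mem_comap, iterateFrobenius_def] at this

theorem pow_mem_coeffIdeal {n : ℕ} (x : Fin n → T) (m e : ℕ) {f : T⟦X⟧}
    (hf : f ∈ coeffIdeal (Ideal.span (Set.range fun j => x j ^ m)) m) :
    f ^ p ^ e ∈ coeffIdeal (Ideal.span (Set.range fun j => x j ^ (m * p ^ e))) (m * p ^ e) := by
  have hle : coeffIdeal (Ideal.span (Set.range fun j => x j ^ m)) m ≤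
      (coeffIdeal (Ideal.span (Set.range fun j => x j ^ (m * p ^ e))) (m * p ^ e)).comap
        (iterateFrobenius T⟦X⟧ p e) := by
    apply coeffIdeal_le
    · rw [Ideal.mem_comap, iterateFrobenius_def, ← pow_mul, ← mul_one (X ^ _)]
      exact X_pow_mul_mem_coeffIdeal le_rfl _
    · intro a ha i _
      rw [Ideal.mem_comap, iterateFrobenius_def, mul_pow, ← map_pow]
      exact C_mul_mem_coeffIdeal (pow_mem_span_pow p x m e ha) _
  have := hle hf
  rwa [Ideal.mem_comap, iterateFrobenius_def] at this

end Frobenius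

section Local

variable [IsLocalRing T]

theorem mem_maximalIdeal_powerSeries {f : T⟦X⟧} :
    f ∈ maximalIdeal T⟦X⟧ ↔ coeff 0 f ∈ maximalIdeal T := by
  rw [mem_maximalIdeal, mem_maximalIdeal, mem_nonunits_iff, mem_nonunits_iff,
    PowerSeries.isUnit_iff_constantCoeff, coeff_zero_eq_constantCoeff_apply]

theorem X_mem_maximalIdeal : (X : T⟦X⟧) ∈ maximalIdeal T⟦X⟧ := by
  rw [mem_maximalIdeal_powerSeries, coeff_zero_X]; exact Ideal.zero_mem _

theorem C_mem_maximalIdeal {a : T} (ha : a ∈ maximalIdeal T) : C a ∈ maximalIdeal T⟦X⟧ := by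
  rwa [mem_maximalIdeal_powerSeries, coeff_zero_C]

theorem coeff_mem_pow_of_mem_maximalIdeal_pow {N : ℕ} {f : T⟦X⟧}
    (hf : f ∈ maximalIdeal T⟦X⟧ ^ N) (i : ℕ) : coeff i f ∈ maximalIdeal T ^ (N - i) := by
  induction N generalizing f i with
  | zero => simp
  | succ N ih =>
    rw [pow_succ'] at hf
    induction hf using Submodule.mul_induction_on' with
    | add f _ g _ hf hg => rw [map_add]; exact Ideal.add_mem _ hf hg
    | mem_mul_mem f hf g hg =>
      rw [coeff_mul]
      refine Ideal.sum_mem _ fun ij hij => ?_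
      have hij' := Finset.HasAntidiagonal.mem_antidiagonal.1 hij
      rcases Nat.eq_zero_or_pos ij.1 with h0 | h0
      · have h1 : coeff ij.1 f ∈ maximalIdeal T := by
          rw [h0]; exact mem_maximalIdeal_powerSeries.1 hf
        have h2 := Ideal.mul_mem_mul h1 (ih hg ij.2)
        rw [← pow_succ'] at h2
        exact Ideal.pow_le_pow_right (by omega) h2
      · exact Ideal.mul_mem_left _ _ (Ideal.pow_le_pow_right (by omega) (ih hg ij.2))

theorem C_mem_maximalIdeal_pow {a : T} {n : ℕ} (ha : a ∈ maximalIdeal T ^ n) :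
    C a ∈ maximalIdeal T⟦X⟧ ^ n := by
  have h1 : (maximalIdeal T).map (C : T →+* T⟦X⟧) ≤ maximalIdeal T⟦X⟧ :=
    Ideal.map_le_iff_le_comap.2 fun b hb => C_mem_maximalIdeal hb
  have h2 := Ideal.mem_map_of_mem (C : T →+* T⟦X⟧) ha
  rw [Ideal.map_pow] at h2
  exact Ideal.pow_right_mono h1 n h2

theorem coeffIdeal_le_maximalIdeal_pow {K : Ideal T} {n m : ℕ} (hK : K ≤ maximalIdeal T ^ n)
    (h : n ≤ m) : coeffIdeal K m ≤ maximalIdeal T⟦X⟧ ^ n := by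
  apply coeffIdeal_le
  · exact Ideal.pow_le_pow_right h (Ideal.pow_mem_pow X_mem_maximalIdeal m)
  · exact fun a ha i _ => Ideal.mul_mem_right _ _ (C_mem_maximalIdeal_pow (hK ha))

theorem maximalIdeal_pow_le_coeffIdeal {K : Ideal T} {M n : ℕ} (hK : maximalIdeal T ^ M ≤ K) :
    maximalIdeal T⟦X⟧ ^ (n + M) ≤ coeffIdeal K n := fun f hf i hi =>
  hK (Ideal.pow_le_pow_right (by omega) (coeff_mem_pow_of_mem_maximalIdeal_pow hf i))

end Local

end PowerSeriesIdeals

section Krull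

theorem mem_of_forall_mem_sup_pow {S : Type*} [CommRing S] [IsLocalRing S] [IsNoetherianRing S]
    {I : Ideal S} {x : S} (h : ∀ n, x ∈ I ⊔ maximalIdeal S ^ n) : x ∈ I := by
  have := Ideal.iInf_pow_smul_eq_bot_of_isLocalRing (M := S ⧸ I) (maximalIdeal S)
    (maximalIdeal.isMaximal S).ne_top
  rw [← Ideal.Quotient.eq_zero_iff_mem, ← Submodule.mem_bot S, ← this, Submodule.mem_iInf]
  intro n
  obtain ⟨i, hi, m, hm, rfl⟩ := Submodule.mem_sup.1 (h n)
  rw [map_add, Ideal.Quotient.eq_zero_iff_mem.2 hi, zero_add]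
  have h1 : m • (1 : S ⧸ I) ∈ (maximalIdeal S ^ n • ⊤ : Submodule S (S ⧸ I)) :=
    Submodule.smul_mem_smul hm trivial
  rwa [Algebra.smul_def, mul_one] at h1

theorem Ideal.frobPow_mono {R : Type*} [CommRing R] {I J : Ideal R} (h : I ≤ J) (q : ℕ) :
    I.frobPow q ≤ J.frobPow q := Ideal.span_mono (Set.image_mono h)

end Krull

section Socle

variable {T : Type*} [CommRing T] [IsLocalRing T]

theorem mem_colon_maximalIdeal {I : Ideal T} {a : T} :
    a ∈ I.colon (maximalIdeal T : Set T) ↔ ∀ s ∈ maximalIdeal T, s * a ∈ I := by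
  simp only [Submodule.mem_colon, smul_eq_mul, mul_comm a]; rfl

variable [IsNoetherianRing T]

theorem IsGorensteinLocal.mem_sup_span_of_colon (hGor : IsGorensteinLocal T) {n : ℕ}
    (hn : (n : WithBot ℕ∞) = ringKrullDim T) {x : Fin n → T}
    (hx : (Ideal.span (Set.range x)).radical = maximalIdeal T)
    {y : T} (hy : IsSocleGenerator (Ideal.span (Set.range x)) y) (k : ℕ) :
    (y * ∏ i, x i ^ k ∉ Ideal.span (Set.range fun j => x j ^ (k + 1))) ∧
    (∀ s ∈ maximalIdeal T, s * (y * ∏ i, x i ^ k) ∈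
      Ideal.span (Set.range fun j => x j ^ (k + 1))) ∧
    ∀ a, (∀ s ∈ maximalIdeal T, s * a ∈ Ideal.span (Set.range fun j => x j ^ (k + 1))) →
      a ∈ Ideal.span (Set.range fun j => x j ^ (k + 1)) ⊔ Ideal.span {y * ∏ i, x i ^ k} := by
  set K := Ideal.span (Set.range fun j => x j ^ (k + 1)) with hK
  have hnot : y * ∏ i, x i ^ k ∉ K := by
    intro h
    rw [hK] at h
    simp only [add_comm k 1] at h
    have := hGor.1.mem_span_pow hn hx one_pos k h
    simp only [pow_one] at this
    exact hy.1 this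
  have hsoc : ∀ s ∈ maximalIdeal T, s * (y * ∏ i, x i ^ k) ∈ K := by
    intro s hs
    have hle : Ideal.span (Set.range x) ≤ K.colon {∏ i, x i ^ k} := by
      rw [Ideal.span_le]
      rintro _ ⟨j, rfl⟩
      rw [SetLike.mem_coe, Submodule.mem_colon_singleton, smul_eq_mul,
        ← Finset.mul_prod_erase _ _ (Finset.mem_univ j), ← mul_assoc, ← pow_succ']
      exact K.mul_mem_right _ (Ideal.subset_span ⟨j, rfl⟩)
    have hsy : s * y ∈ Ideal.span (Set.range x) := by
      refine mem_colon_maximalIdeal.1 ?_ s hs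
      rw [hy.2]
      exact Ideal.mem_sup_right (Ideal.mem_span_singleton_self y)
    have := Submodule.mem_colon_singleton.1 (hle hsy)
    rwa [smul_eq_mul, mul_assoc] at this
  refine ⟨hnot, hsoc, fun a ha => ?_⟩
  obtain ⟨w, hw, hcol⟩ := hGor.2 K
    ⟨n, _, hK, radical_span_pow hx (fun _ => k + 1) fun _ => Nat.succ_pos k, hn⟩
  have hY : y * ∏ i, x i ^ k ∈ K ⊔ Ideal.span {w} := by
    rw [← hcol]; exact mem_colon_maximalIdeal.2 hsoc
  have ha' : a ∈ K ⊔ Ideal.span {w} := by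
    rw [← hcol]; exact mem_colon_maximalIdeal.2 ha
  have hwm : ∀ s ∈ maximalIdeal T, s * w ∈ K :=
    mem_colon_maximalIdeal.1 <| by
      rw [hcol]
      exact Ideal.mem_sup_right (Ideal.mem_span_singleton_self w)
  obtain ⟨r, hr⟩ := mem_sup_span_singleton.1 hY
  obtain ⟨b, hb⟩ := mem_sup_span_singleton.1 ha'
  have hru : IsUnit r := by
    by_contra h
    apply hnot
    have := K.add_mem hr (hwm r ((mem_maximalIdeal _).2 h))
    rwa [mul_comm r w, sub_add_cancel] at this
  obtain ⟨v, rfl⟩ := hru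
  refine mem_sup_span_singleton.2 ⟨↑v⁻¹ * b, ?_⟩
  have : a - y * (∏ i, x i ^ k) * (↑v⁻¹ * b) =
      (a - w * b) - (y * (∏ i, x i ^ k) - w * v) * (↑v⁻¹ * b) := by
    have hv : (v : T) * ↑v⁻¹ = 1 := v.mul_inv
    linear_combination (-(w * b)) * hv
  rw [this]
  exact K.sub_mem hb (K.mul_mem_right _ hr)

end Socle

section Purity

open PowerSeries

variable {T : Type*} [CommRing T] [IsLocalRing T] [IsNoetherianRing T]

theorem exists_mul_mem_coeffIdeal {K : Ideal T} {Y : T} {k : ℕ} (hm : ∃ M, maximalIdeal T ^ M ≤ K)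
    (hKm : K ≤ maximalIdeal T) (hY : ∀ s ∈ maximalIdeal T, s * Y ∈ K)
    (hK : ∀ a, (∀ s ∈ maximalIdeal T, s * a ∈ K) → a ∈ K ⊔ Ideal.span {Y})
    {I : Ideal T⟦X⟧} (hI : coeffIdeal K (k + 1) ≤ I) {z : T⟦X⟧} (hz : z ∉ I) :
    ∃ w, (∀ i ∈ I, w * i ∈ coeffIdeal K (k + 1)) ∧
      w * z - C Y * X ^ k ∈ coeffIdeal K (k + 1) := by
  set J := coeffIdeal K (k + 1) with hJ
  obtain ⟨M, hM⟩ := hm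
  have hJm : J ≤ maximalIdeal T⟦X⟧ := fun f hf =>
    mem_maximalIdeal_powerSeries.2 (hKm (hf 0 (Nat.succ_pos k)))
  have hne : J ≠ ⊤ := fun h => (maximalIdeal.isMaximal T⟦X⟧).ne_top (top_le_iff.1 (h ▸ hJm))
  have : Nontrivial (T⟦X⟧ ⧸ J) := Ideal.Quotient.nontrivial_iff.2 hne
  have : IsLocalRing (T⟦X⟧ ⧸ J) :=
    IsLocalRing.of_surjective' (Ideal.Quotient.mk J) Ideal.Quotient.mk_surjective
  have hloc : ∀ f, Ideal.Quotient.mk J f ∈ maximalIdeal (T⟦X⟧ ⧸ J) →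
      f ∈ maximalIdeal T⟦X⟧ := by
    intro f hf
    rw [mem_maximalIdeal, mem_nonunits_iff] at hf ⊢
    exact fun hu => hf (hu.map _)
  have hnil : IsNilpotent (maximalIdeal (T⟦X⟧ ⧸ J)) := by
    refine ⟨k + 1 + M, ?_⟩
    have hmax : maximalIdeal (T⟦X⟧ ⧸ J) ≤ (maximalIdeal T⟦X⟧).map (Ideal.Quotient.mk J) := by
      intro b hb
      obtain ⟨f, rfl⟩ := Ideal.Quotient.mk_surjective b
      exact Ideal.mem_map_of_mem _ (hloc f hb)
    rw [Ideal.zero_eq_bot, eq_bot_iff]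
    refine (Ideal.pow_right_mono hmax _).trans ?_
    rw [← Ideal.map_pow]
    refine (Ideal.map_mono (maximalIdeal_pow_le_coeffIdeal hM)).trans ?_
    rw [← hJ, Ideal.map_quotient_self]
  have : IsArtinianRing (T⟦X⟧ ⧸ J) := (isArtinianRing_iff_isNilpotent_maximalIdeal _).2 hnil
  obtain ⟨u, hu, huz⟩ := exists_annihilator_mul_eq (B := T⟦X⟧ ⧸ J)
    (s := Ideal.Quotient.mk J (C Y * X ^ k)) (by
      intro b hb
      obtain ⟨f, rfl⟩ := Ideal.Quotient.mk_surjective b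
      rw [← map_mul, Ideal.Quotient.eq_zero_iff_mem, mem_coeffIdeal]
      intro i hi
      rw [mul_left_comm, coeff_C_mul, coeff_mul_X_pow']
      split_ifs with h
      · have : i - k = 0 := by omega
        rw [this, mul_comm]
        exact hY _ (mem_maximalIdeal_powerSeries.1 (hloc f hb))
      · simp) (by
      intro b hb
      obtain ⟨f, rfl⟩ := Ideal.Quotient.mk_surjective b
      have hf : ∀ g ∈ maximalIdeal T⟦X⟧, g * f ∈ J := by
        intro g hg
        by_cases hgu : IsUnit (Ideal.Quotient.mk J g)
        · exfalso
          have h1 : IsUnit g := by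
            by_contra h1
            obtain ⟨v, hv⟩ := hgu.exists_right_inv
            obtain ⟨v, rfl⟩ := Ideal.Quotient.mk_surjective v
            rw [← map_mul, ← map_one (Ideal.Quotient.mk J), Ideal.Quotient.eq] at hv
            have h2 := Ideal.sub_mem _ (Ideal.mul_mem_right v _ hg) (hJm hv)
            rw [sub_sub_cancel] at h2
            exact (Ideal.ne_top_iff_one _).1 (maximalIdeal.isMaximal T⟦X⟧).ne_top h2
          exact (mem_maximalIdeal _).1 hg h1
        · have := hb _ ((mem_maximalIdeal _).2 hgu)
          rwa [← map_mul, Ideal.Quotient.eq_zero_iff_mem] at this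
      have hlow : ∀ i < k, coeff i f ∈ K := by
        intro i hi
        have := hf X X_mem_maximalIdeal (i + 1) (by omega)
        rwa [coeff_succ_X_mul] at this
      have htop : coeff k f ∈ K ⊔ Ideal.span {Y} := by
        refine hK _ fun s hs => ?_
        have := hf (C s) (C_mem_maximalIdeal hs) k (by omega)
        rwa [coeff_C_mul] at this
      obtain ⟨r, hr⟩ := mem_sup_span_singleton.1 htop
      rw [Ideal.mem_span_singleton']
      refine ⟨Ideal.Quotient.mk J (C r), ?_⟩
      rw [← map_mul, eq_comm, Ideal.Quotient.eq, mem_coeffIdeal]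
      intro i hi
      rw [map_sub, ← mul_assoc, ← map_mul, coeff_C_mul_X_pow]
      split_ifs with h
      · rw [h, mul_comm]; exact hr
      · rw [sub_zero]; exact hlow i (by omega))
    (I := I.map (Ideal.Quotient.mk J)) (x := Ideal.Quotient.mk J z) (by
      intro h
      have h1 : z ∈ (I.map (Ideal.Quotient.mk J)).comap (Ideal.Quotient.mk J) := h
      rw [Ideal.comap_map_of_surjective _ Ideal.Quotient.mk_surjective,
        ← RingHom.ker_eq_comap_bot, Ideal.mk_ker, sup_eq_left.2 hI] at h1
      exact hz h1)
  obtain ⟨w, rfl⟩ := Ideal.Quotient.mk_surjective u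
  refine ⟨w, fun i hi => ?_, ?_⟩
  · have := hu _ (Ideal.mem_map_of_mem _ hi)
    rwa [← map_mul, Ideal.Quotient.eq_zero_iff_mem] at this
  · rwa [← map_mul, Ideal.Quotient.eq] at huz

/-- Multiplication by a power series with a unit coefficient in low degree followed by Frobenius
reflects membership in every ideal. -/
theorem mem_of_mul_pow_mem_frobPow (p : ℕ) [Fact p.Prime] [CharP T p]
    (hGor : IsGorensteinLocal T) {I₀ : Ideal T} (hI₀ : IsParameterIdeal T I₀)
    {y : T} (hy : IsSocleGenerator I₀ y)
    (h1 : ∀ e : ℕ, y ^ p ^ e ∉ I₀.frobPow (p ^ e))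
    {c : T⟦X⟧} {j e : ℕ} (hc : IsUnit (coeff j c)) (he : j < p ^ e) {I : Ideal T⟦X⟧} {z : T⟦X⟧}
    (h : c * z ^ p ^ e ∈ I.frobPow (p ^ e)) : z ∈ I := by
  obtain ⟨n, x, rfl, hx, hn⟩ := hI₀
  by_contra hz
  have hxm : ∀ i, x i ∈ maximalIdeal T := fun i => by
    rw [← hx]; exact Ideal.le_radical (Ideal.subset_span ⟨i, rfl⟩)
  obtain ⟨k, hk⟩ : ∃ k, z ∉ I ⊔
      coeffIdeal (Ideal.span (Set.range fun j => x j ^ (k + 1))) (k + 1) := by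
    by_contra! hcon
    refine hz (mem_of_forall_mem_sup_pow fun m => ?_)
    refine sup_le_sup_left (coeffIdeal_le_maximalIdeal_pow ?_ (Nat.le_succ m)) I (hcon m)
    rw [Ideal.span_le]
    rintro _ ⟨i, rfl⟩
    exact Ideal.pow_le_pow_right (Nat.le_succ m) (Ideal.pow_mem_pow (hxm i) _)
  obtain ⟨-, hsoc, hcol⟩ := hGor.mem_sup_span_of_colon hn hx hy k
  have hrad := radical_span_pow hx (fun _ => k + 1) fun _ => Nat.succ_pos k
  obtain ⟨w, hw, hwz⟩ := exists_mul_mem_coeffIdeal (I := I ⊔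
      coeffIdeal (Ideal.span (Set.range fun j => x j ^ (k + 1))) (k + 1))
    (by
      obtain ⟨M, hM⟩ := Ideal.exists_radical_pow_le_of_fg
        (Ideal.span (Set.range fun j => x j ^ (k + 1))) (IsNoetherian.noetherian _)
      rw [hrad] at hM
      exact ⟨M, hM⟩)
    (by rw [← hrad]; exact Ideal.le_radical) hsoc hcol le_sup_right hk
  set q := p ^ e with hq
  have hqpos : 0 < q := pow_pos (Fact.out : p.Prime).pos e
  set J := coeffIdeal (Ideal.span (Set.range fun j => x j ^ ((k + 1) * q))) ((k + 1) * q) with hJ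
  have h2 : c * (w * z) ^ q ∈ J := by
    have hle : (I ⊔ coeffIdeal (Ideal.span (Set.range fun j => x j ^ (k + 1))) (k + 1)).frobPow q
        ≤ J.colon {w ^ q} := by
      rw [Ideal.frobPow, Ideal.span_le]
      rintro _ ⟨f, hf, rfl⟩
      rw [SetLike.mem_coe, Submodule.mem_colon_singleton, smul_eq_mul, mul_comm]
      dsimp only
      rw [← mul_pow]
      exact pow_mem_coeffIdeal p x (k + 1) e (hw f hf)
    have := Submodule.mem_colon_singleton.1 (hle (Ideal.frobPow_mono le_sup_left q h))
    rw [smul_eq_mul] at this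
    convert this using 1
    ring
  have h3 : c * (C (y * ∏ i, x i ^ k) * X ^ k) ^ q ∈ J := by
    have h4 : (w * z - C (y * ∏ i, x i ^ k) * X ^ k) ^ q ∈ J :=
      pow_mem_coeffIdeal p x (k + 1) e hwz
    rw [hq, sub_pow_char_pow] at h4
    have := J.sub_mem h2 (J.mul_mem_left c h4)
    convert this using 1
    ring
  have h5 := h3 (j + k * q) (by nlinarith)
  rw [mul_pow, ← pow_mul, ← map_pow, mul_left_comm, coeff_C_mul, coeff_mul_X_pow] at h5
  obtain ⟨v, hv⟩ := hc
  have h6 : y ^ q * ∏ i, x i ^ (k * q) ∈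
      Ideal.span (Set.range fun j => x j ^ (q + k * q)) := by
    have := Ideal.mul_mem_left _ (↑v⁻¹ : T) h5
    rw [← hv, mul_left_comm, Units.inv_mul, mul_one, mul_pow, ← Finset.prod_pow] at this
    simp only [← pow_mul] at this
    convert this using 6
    ring
  have h7 := hGor.1.mem_span_pow hn hx hqpos (k * q) h6
  refine h1 e (Ideal.span_mono ?_ h7)
  rintro _ ⟨i, rfl⟩
  exact ⟨x i, Ideal.subset_span ⟨i, rfl⟩, rfl⟩

end Purity

section Coprime

variable {S : Type*} [CommRing S]

/-- `a` is a nonzerodivisor modulo `b`. -/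
def CoprimeMod (a b : S) : Prop := ∀ x, b ∣ a * x → b ∣ x

theorem coprimeMod_iff {a b : S} : CoprimeMod a b ↔ RegularMod (Ideal.span {b}) a := by
  simp only [CoprimeMod, RegularMod, Ideal.mem_span_singleton]

theorem CoprimeMod.symm {a b : S} (h : CoprimeMod a b) (hb : b ∈ nonZeroDivisors S) :
    CoprimeMod b a := by
  rintro x ⟨y, hy⟩
  obtain ⟨w, rfl⟩ := h y ⟨x, hy.symm⟩
  exact ⟨w, (mul_cancel_left_mem_nonZeroDivisors hb).1 (by rw [hy]; ring)⟩

theorem CoprimeMod.pow_left {a b : S} (h : CoprimeMod a b) (n : ℕ) : CoprimeMod (a ^ n) b := by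
  rw [coprimeMod_iff] at h ⊢
  exact h.pow n

theorem CoprimeMod.pow {a b : S} (h : CoprimeMod a b) (ha : a ∈ nonZeroDivisors S)
    (hb : b ∈ nonZeroDivisors S) (n : ℕ) : CoprimeMod (a ^ n) (b ^ n) :=
  (((h.pow_left n).symm hb).pow_left n).symm (pow_mem ha n)

/-- Associated primes of principal ideals generated by nonzerodivisors do not depend on the
generator. -/
theorem IsAssMod.of_mem {b r : S} {J : Ideal S} (hJ : IsAssMod (Ideal.span {b}) J)
    (hb : b ∈ nonZeroDivisors S) (hr : r ∈ nonZeroDivisors S) (hrJ : r ∈ J) :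
    IsAssMod (Ideal.span {r}) J := by
  obtain ⟨hp, x, hx⟩ := hJ
  obtain ⟨y, hy⟩ := Ideal.mem_span_singleton.1 ((hx r).1 hrJ)
  refine ⟨hp, y, fun s => ?_⟩
  rw [hx, Ideal.mem_span_singleton, Ideal.mem_span_singleton]
  constructor
  · rintro ⟨w, hw⟩
    refine ⟨w, (mul_cancel_left_mem_nonZeroDivisors hb).1 ?_⟩
    linear_combination r * hw - s * hy
  · rintro ⟨w, hw⟩
    refine ⟨w, (mul_cancel_left_mem_nonZeroDivisors hr).1 ?_⟩
    linear_combination b * hw + s * hy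

/-- A subring meeting `P` trivially, closed under division in the ambient ring, in which greatest
common divisors exist and yield cofactors that are coprime in the ambient ring. -/
structure IsGoodSubring (P : Ideal S) (R : Subring S) : Prop where
  eq_zero_of_mem : ∀ r ∈ R, r ∈ P → r = 0
  mem_of_mul_mem : ∀ r ∈ R, r ≠ 0 → ∀ s, r * s ∈ R → s ∈ R
  exists_coprimeMod : ∀ a ∈ R, ∀ b ∈ R, a ≠ 0 → b ≠ 0 →
    ∃ a' ∈ R, ∃ b' ∈ R, a' ≠ 0 ∧ b' ≠ 0 ∧ CoprimeMod a' b' ∧ a * b' = b * a'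

namespace IsGoodSubring

variable {P : Ideal S} {R : Subring S}

theorem notMem (hR : IsGoodSubring P R) {r : R} (h0 : r ≠ 0) : (r : S) ∉ P := fun h =>
  h0 (Subtype.ext (hR.eq_zero_of_mem r r.2 h))

theorem mem_nonZeroDivisors (hR : IsGoodSubring P R) (hP : ∀ s ∉ P, s ∈ nonZeroDivisors S)
    {r : R} (h0 : r ≠ 0) : (r : S) ∈ nonZeroDivisors S := hP _ (hR.notMem h0)

theorem dvd_of_coe_dvd (hR : IsGoodSubring P R) {a b : R} (h : (a : S) ∣ b) : a ∣ b := by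
  by_cases ha : a = 0
  · subst ha
    obtain ⟨s, hs⟩ := h
    exact ⟨0, Subtype.ext (by simpa using hs)⟩
  obtain ⟨s, hs⟩ := h
  exact ⟨⟨s, hR.mem_of_mul_mem a a.2 (fun h => ha (Subtype.ext h)) s (hs ▸ b.2)⟩,
    Subtype.ext hs⟩

theorem isDomain (hR : IsGoodSubring P R) (hP : ∀ s ∉ P, s ∈ nonZeroDivisors S)
    [Nontrivial S] : IsDomain R := by
  have : NoZeroDivisors R := ⟨fun {a b} h => by
    by_cases ha : a = 0
    · exact Or.inl ha
    · refine Or.inr (Subtype.ext ?_)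
      refine (mul_cancel_left_mem_nonZeroDivisors (hR.mem_nonZeroDivisors hP ha)).1 ?_
      simpa using congrArg Subtype.val h⟩
  exact NoZeroDivisors.to_isDomain R

theorem exists_eq_mul (hR : IsGoodSubring P R) (hP : ∀ s ∉ P, s ∈ nonZeroDivisors S)
    {a b : R} (ha : a ≠ 0) (hb : b ≠ 0) :
    ∃ g a' b' : R, a = g * a' ∧ b = g * b' ∧ a' ≠ 0 ∧ b' ≠ 0 ∧ CoprimeMod (a' : S) b' := by
  obtain ⟨a', ha', b', hb', h0, h0', hc, h⟩ := hR.exists_coprimeMod a a.2 b b.2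
    (fun h => ha (Subtype.ext h)) (fun h => hb (Subtype.ext h))
  have h1 : b' ∣ (b : S) := hc _ ⟨a, by rw [mul_comm a', ← h, mul_comm]⟩
  obtain ⟨g, hg⟩ := h1
  have hgR : g ∈ R := hR.mem_of_mul_mem b' hb' h0' g (hg ▸ b.2)
  have hreg : b' ∈ nonZeroDivisors S :=
    hR.mem_nonZeroDivisors hP (r := ⟨b', hb'⟩) fun h => h0' (congrArg Subtype.val h)
  refine ⟨⟨g, hgR⟩, ⟨a', ha'⟩, ⟨b', hb'⟩, Subtype.ext ?_, Subtype.ext ?_,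
    fun h => h0 (congrArg Subtype.val h), fun h => h0' (congrArg Subtype.val h), hc⟩
  · refine (mul_cancel_left_mem_nonZeroDivisors hreg).1 ?_
    change b' * (a : S) = b' * (g * a')
    rw [mul_comm, h, hg]; ring
  · change (b : S) = g * b'
    rw [hg, mul_comm]

theorem coprimeMod_of_isRelPrime (hR : IsGoodSubring P R) (hP : ∀ s ∉ P, s ∈ nonZeroDivisors S)
    {a b : R} (ha : a ≠ 0) (hb : b ≠ 0) (h : IsRelPrime a b) : CoprimeMod (a : S) b := by
  obtain ⟨g, a', b', rfl, rfl, ha', hb', hc⟩ := hR.exists_eq_mul hP ha hb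
  have hg : IsUnit g := h ⟨a', rfl⟩ ⟨b', rfl⟩
  have hg' : IsUnit (g : S) := hg.map R.subtype
  intro x hx
  simp only [Subring.coe_mul, mul_assoc] at hx ⊢
  rw [hg'.mul_left_dvd]
  exact hc x ((hg'.dvd_mul_left).1 ((hg'.mul_left_dvd).1 hx))

theorem uniqueFactorizationMonoid [IsNoetherianRing S] [Nontrivial S] (hR : IsGoodSubring P R)
    (hP : ∀ s ∉ P, s ∈ nonZeroDivisors S) : UniqueFactorizationMonoid R := by
  have := hR.isDomain hP
  have hwf : IsWellFounded R DvdNotUnit := by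
    refine ⟨?_⟩
    have hw : WellFounded fun a b : Ideal S => a > b := wellFounded_gt
    refine Subrelation.wf ?_ (InvImage.wf (fun r : R => Ideal.span {(r : S)}) hw)
    rintro a b ⟨ha, x, hx, rfl⟩
    change Ideal.span {((a * x : R) : S)} < Ideal.span {(a : S)}
    refine lt_of_le_of_ne (Ideal.span_singleton_le_span_singleton.2 ⟨x, rfl⟩) fun h => ?_
    have h1 : a * x ∣ a := hR.dvd_of_coe_dvd (Ideal.span_singleton_le_span_singleton.1 h.ge)
    obtain ⟨w, hw⟩ := h1
    refine hx (IsUnit.of_mul_eq_one w (mul_left_cancel₀ ha ?_))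
    rw [← mul_assoc, ← hw, mul_one]
  refine ⟨fun {π} => ⟨fun hπ => ⟨hπ.ne_zero, hπ.not_isUnit, fun a b hab => ?_⟩, Prime.irreducible⟩⟩
  by_cases ha : a = 0
  · exact Or.inl (ha ▸ dvd_zero π)
  by_cases h : π ∣ a
  · exact Or.inl h
  right
  have := hR.coprimeMod_of_isRelPrime hP ha hπ.ne_zero (hπ.isRelPrime_iff_not_dvd.2 h).symm
  refine hR.dvd_of_coe_dvd (this b ?_)
  rw [← Subring.coe_mul]
  exact map_dvd R.subtype hab

/-- The contraction of an associated prime of a nonzero principal ideal of the subring is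
principal. -/
theorem exists_prime_of_isAssMod [IsNoetherianRing S] [Nontrivial S] (hR : IsGoodSubring P R)
    (hP : ∀ s ∉ P, s ∈ nonZeroDivisors S) {J : Ideal S} {r : R} (hr : r ≠ 0)
    (hJ : IsAssMod (Ideal.span {(r : S)}) J) :
    ∃ π : R, Prime π ∧ ∀ d : R, (d : S) ∈ J ↔ π ∣ d := by
  have := hR.isDomain hP
  have := hR.uniqueFactorizationMonoid hP
  have hJp := hJ.1
  have hQ : (J.comap R.subtype).IsPrime := inferInstance
  have hrJ : r ∈ J.comap R.subtype := hJ.le (Ideal.mem_span_singleton_self _)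
  obtain ⟨π, hπ, hpr⟩ := hQ.exists_mem_prime_of_ne_bot fun h => hr (by
    rwa [h, Ideal.mem_bot] at hrJ)
  refine ⟨π, hpr, fun d => ⟨fun hd => ?_, fun hd => ?_⟩⟩
  · by_contra hnd
    have hd0 : d ≠ 0 := fun h => hnd (h ▸ dvd_zero π)
    have hc := hR.coprimeMod_of_isRelPrime hP hd0 hpr.ne_zero
      (hpr.irreducible.isRelPrime_iff_not_dvd.2 hnd).symm
    have hJ' := hJ.of_mem (hR.mem_nonZeroDivisors hP hr) (hR.mem_nonZeroDivisors hP hpr.ne_zero) hπ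
    exact hJ'.notMem (coprimeMod_iff.1 hc) hd
  · exact J.mem_of_dvd (map_dvd R.subtype hd) hπ

end IsGoodSubring

end Coprime

section PolynomialBezout

open Polynomial

theorem Polynomial.isRelPrime_map_of_isRelPrime {D K : Type*} [CommRing D] [IsDomain D]
    [UniqueFactorizationMonoid D] [Field K] [Algebra D K] [IsFractionRing D K] {h g : D[X]}
    (h0 : h ≠ 0) (hrel : IsRelPrime h g) :
    IsRelPrime (h.map (algebraMap D K)) (g.map (algebraMap D K)) := by
  classical
  let _ : StrongNormalizationMonoid D := UniqueFactorizationMonoid.strongNormalizationMonoid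
  let _ : NormalizedGCDMonoid D := UniqueFactorizationMonoid.toNormalizedGCDMonoid D
  intro d hdh hdg
  have hd0 : d ≠ 0 := by
    rintro rfl
    rw [zero_dvd_iff, Polynomial.map_eq_zero_iff (IsFractionRing.injective D K)] at hdh
    exact h0 hdh
  obtain ⟨b, hb, hbd⟩ := IsLocalization.integerNormalization_spec (nonZeroDivisors D) d
  set n := IsLocalization.integerNormalization (nonZeroDivisors D) d with hn
  have hb0 : algebraMap D K b ≠ 0 := IsFractionRing.to_map_ne_zero_of_mem_nonZeroDivisors hb
  have hn0 : n ≠ 0 := by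
    intro h
    rw [h, Polynomial.map_zero, algebra_compatible_smul K] at hbd
    exact smul_ne_zero hb0 hd0 hbd.symm
  have hc0 : algebraMap D K n.content ≠ 0 := by
    rw [Ne, map_eq_zero_iff _ (IsFractionRing.injective D K), content_eq_zero_iff]
    exact hn0
  have hass : n.primPart.map (algebraMap D K) ∣ d ∧ d ∣ n.primPart.map (algebraMap D K) := by
    have h1 : C (algebraMap D K n.content) * n.primPart.map (algebraMap D K) =
        C (algebraMap D K b) * d := by
      rw [← Polynomial.map_C, ← Polynomial.map_mul, ← eq_C_content_mul_primPart, hbd,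
        algebra_compatible_smul K, smul_eq_C_mul]
    have hu : IsUnit (C (algebraMap D K n.content)) := isUnit_C.2 hc0.isUnit
    have hu' : IsUnit (C (algebraMap D K b)) := isUnit_C.2 hb0.isUnit
    constructor
    · rw [← hu'.dvd_mul_left (b := d), ← h1]; exact dvd_mul_left _ _
    · rw [← hu.dvd_mul_left, h1]; exact dvd_mul_left _ _
  have hprim := n.isPrimitive_primPart
  have hunit : IsUnit n.primPart := hrel
    (hprim.dvd_of_fraction_map_dvd_fraction_map (hass.1.trans hdh))
    (hprim.dvd_of_fraction_map_dvd_fraction_map (hass.1.trans hdg))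
  exact isUnit_of_dvd_unit hass.2 (hunit.map (mapRingHom (algebraMap D K)))

theorem Polynomial.exists_mul_add_mul_eq_C {D : Type*} [CommRing D] [IsDomain D]
    [UniqueFactorizationMonoid D] {h g : D[X]} (h0 : h ≠ 0) (hrel : IsRelPrime h g) :
    ∃ (u v : D[X]) (r : D), r ≠ 0 ∧ u * h + v * g = C r := by
  obtain ⟨u, v, huv⟩ := (Polynomial.isRelPrime_map_of_isRelPrime (K := FractionRing D) h0
    hrel).isCoprime
  obtain ⟨b, hb, hbu⟩ := IsLocalization.integerNormalization_spec (nonZeroDivisors D) u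
  obtain ⟨c, hc, hcv⟩ := IsLocalization.integerNormalization_spec (nonZeroDivisors D) v
  refine ⟨C c * IsLocalization.integerNormalization (nonZeroDivisors D) u,
    C b * IsLocalization.integerNormalization (nonZeroDivisors D) v, b * c,
    nonZeroDivisors.ne_zero (mul_mem hb hc), ?_⟩
  apply Polynomial.map_injective _ (IsFractionRing.injective D (FractionRing D))
  simp only [Polynomial.map_add, Polynomial.map_mul, Polynomial.map_C, hbu, hcv, map_mul]
  rw [algebra_compatible_smul (FractionRing D) b, algebra_compatible_smul (FractionRing D) c,
    smul_eq_C_mul, smul_eq_C_mul]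
  linear_combination C (algebraMap D (FractionRing D) b) *
    C (algebraMap D (FractionRing D) c) * huv

end PolynomialBezout

section Extension

open Polynomial

variable {S : Type*} [CommRing S]

/-- The associated primes of nonzero principal ideals generated by elements of `R`. -/
def assPrimes (R : Subring S) : Set (Ideal S) :=
  {J | ∃ r : R, r ≠ 0 ∧ IsAssMod (Ideal.span {(r : S)}) J}

/-- `z` is transcendental modulo `J` over the image of `R`. -/
def TransMod (R : Subring S) (J : Ideal S) (z : S) : Prop :=
  ∀ h : R[X], aeval z h ∈ J → ∀ i, (h.coeff i : S) ∈ J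

/-- Elements that become members of `R` after multiplication by some element of `R` outside
`P`. -/
def saturation (P : Ideal S) [hP : P.IsPrime] (R : Subring S) : Subring S where
  carrier := {s | ∃ r ∈ R, r ∉ P ∧ r * s ∈ R}
  mul_mem' := by
    rintro a b ⟨r, hr, hrP, hra⟩ ⟨s, hs, hsP, hsb⟩
    refine ⟨r * s, mul_mem hr hs, hP.mul_notMem hrP hsP, ?_⟩
    rw [mul_mul_mul_comm]; exact mul_mem hra hsb
  one_mem' := ⟨1, one_mem R, (Ideal.ne_top_iff_one P).1 hP.ne_top, by simp⟩
  add_mem' := by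
    rintro a b ⟨r, hr, hrP, hra⟩ ⟨s, hs, hsP, hsb⟩
    refine ⟨r * s, mul_mem hr hs, hP.mul_notMem hrP hsP, ?_⟩
    have : r * s * (a + b) = s * (r * a) + r * (s * b) := by ring
    rw [this]; exact add_mem (mul_mem hs hra) (mul_mem hr hsb)
  zero_mem' := ⟨1, one_mem R, (Ideal.ne_top_iff_one P).1 hP.ne_top, by simp⟩
  neg_mem' := by
    rintro a ⟨r, hr, hrP, hra⟩
    exact ⟨r, hr, hrP, by rw [mul_neg]; exact neg_mem hra⟩

theorem le_saturation (P : Ideal S) [hP : P.IsPrime] (R : Subring S) : R ≤ saturation P R :=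
  fun s hs => ⟨1, one_mem R, (Ideal.ne_top_iff_one P).1 hP.ne_top, by simpa using hs⟩

theorem IsGoodSubring.of_saturation {P : Ideal S} [hPp : P.IsPrime] {R : Subring S}
    (hP : ∀ s ∉ P, s ∈ nonZeroDivisors S) (h0 : ∀ r ∈ R, r ∈ P → r = 0)
    (h : ∀ a ∈ R, ∀ b ∈ R, a ≠ 0 → b ≠ 0 → ∃ a' ∈ saturation P R, ∃ b' ∈ saturation P R,
      a' ≠ 0 ∧ b' ≠ 0 ∧ CoprimeMod a' b' ∧ a * b' = b * a') :
    IsGoodSubring P (saturation P R) := by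
  have hz : ∀ r ∈ saturation P R, r ∈ P → r = 0 := by
    rintro s ⟨r, hr, hrP, hrs⟩ hsP
    have := h0 _ hrs (P.mul_mem_left _ hsP)
    exact (mul_right_mem_nonZeroDivisors_eq_zero_iff (hP r hrP)).1 (by rwa [mul_comm])
  refine ⟨hz, ?_, ?_⟩
  · rintro r ⟨a, ha, haP, har⟩ hr0 s ⟨b, hb, hbP, hbs⟩
    have hrP : r ∉ P := fun h => hr0 (hz r ⟨a, ha, haP, har⟩ h)
    refine ⟨b * (a * r), mul_mem hb har, hPp.mul_notMem hbP (hPp.mul_notMem haP hrP), ?_⟩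
    have : b * (a * r) * s = a * (b * (r * s)) := by ring
    rw [this]; exact mul_mem ha hbs
  · rintro a ⟨r, hr, hrP, hra⟩ b ⟨s, hs, hsP, hsb⟩ ha0 hb0
    have hne : ∀ r ∉ P, ∀ a, a ≠ 0 → r * a ≠ 0 := fun r hr a ha h =>
      ha ((mul_right_mem_nonZeroDivisors_eq_zero_iff (hP r hr)).1 (by rwa [mul_comm]))
    obtain ⟨a', ha', b', hb', h1, h2, h3, h4⟩ := h (s * (r * a)) (mul_mem hs hra)
      (r * (s * b)) (mul_mem hr hsb) (hne _ hsP _ (hne _ hrP _ ha0))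
      (hne _ hrP _ (hne _ hsP _ hb0))
    refine ⟨a', ha', b', hb', h1, h2, h3,
      (mul_cancel_left_mem_nonZeroDivisors (hP _ (hPp.mul_notMem hrP hsP))).1 ?_⟩
    linear_combination h4

theorem exists_aeval_eq_pow_mul {R : Subring S} {f₁ f₂ c : R} {z₁ z₂ : S}
    (h12 : f₁ * z₁ + f₂ * z₂ = c) (h : R[X]) :
    ∃ N₀, ∀ N ≥ N₀, ∃ k : R[X], aeval z₂ k = (f₁ : S) ^ N * aeval z₁ h := by
  induction h using Polynomial.induction_on' with
  | add p q hp hq =>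
    obtain ⟨M, hM⟩ := hp
    obtain ⟨L, hL⟩ := hq
    refine ⟨max M L, fun N hN => ?_⟩
    obtain ⟨k, hk⟩ := hM N (le_of_max_le_left hN)
    obtain ⟨l, hl⟩ := hL N (le_of_max_le_right hN)
    exact ⟨k + l, by rw [map_add, map_add, hk, hl, mul_add]⟩
  | monomial n a =>
    refine ⟨n, fun N hN => ⟨C (a * f₁ ^ (N - n)) * (C c - C f₂ * X) ^ n, ?_⟩⟩
    have h1 : (c : S) - f₂ * z₂ = f₁ * z₁ := by rw [← h12]; ring
    obtain ⟨m, rfl⟩ := Nat.exists_eq_add_of_le hN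
    have h2 : ∀ r : R, algebraMap R S r = r := fun _ => rfl
    simp only [map_mul, map_pow, map_sub, aeval_C, aeval_X, aeval_monomial, h2,
      Nat.add_sub_cancel_left, h1]
    ring

theorem TransMod.C_dvd {R : Subring S} {J : Ideal S} {z : S}
    (hz : TransMod R J z) {π : R} (hπ : ∀ d : R, (d : S) ∈ J ↔ π ∣ d) {k : R[X]}
    (hk : aeval z k ∈ J) : C π ∣ k :=
  C_dvd_iff_dvd_coeff _ _ |>.2 fun i => (hπ _).1 (hz k hk i)

namespace IsGoodSubring

variable [IsNoetherianRing S] [Nontrivial S] {P : Ideal S} [P.IsPrime] {R : Subring S}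

theorem exists_factor (hR : IsGoodSubring P R) (hP : ∀ s ∉ P, s ∈ nonZeroDivisors S)
    {f₁ f₂ c : R} {z₁ z₂ : S} (h12 : f₁ * z₁ + f₂ * z₂ = c)
    (hf : CoprimeMod (f₁ : S) f₂) (hf₂ : f₂ ≠ 0) {h : R[X]} (hh : aeval z₁ h ∉ P) (g : R[X]) :
    ∃ δ : R, δ ≠ 0 ∧ ∃ a b : S, aeval z₁ h = δ * a ∧ aeval z₁ g = δ * b ∧
      ∀ J ∈ assPrimes R, (f₂ : S) ∈ J → TransMod R J z₂ → a ∈ J → b ∉ J := by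
  have := hR.isDomain hP
  have := hR.uniqueFactorizationMonoid hP
  by_cases hf₁ : f₁ = 0
  · refine ⟨1, one_ne_zero, _, _, (one_mul _).symm, (one_mul _).symm, fun J hJ hfJ => ?_⟩
    have h1 : (f₂ : S) ∣ 1 := hf 1 (by rw [hf₁]; simp)
    obtain ⟨r, -, hJ⟩ := hJ
    exact absurd ((Ideal.eq_top_iff_one J).2 (J.mem_of_dvd h1 hfJ)) hJ.1.ne_top
  obtain ⟨M, hM⟩ := exists_aeval_eq_pow_mul h12 h
  obtain ⟨L, hL⟩ := exists_aeval_eq_pow_mul h12 g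
  obtain ⟨N, hMN, hLN⟩ : ∃ N, M ≤ N ∧ L ≤ N := ⟨max M L, le_max_left _ _, le_max_right _ _⟩
  obtain ⟨h', hh'⟩ := hM N hMN
  obtain ⟨g', hg'⟩ := hL N hLN
  have hf₁P := hR.notMem hf₁
  have hh0 : h' ≠ 0 := by
    rintro rfl
    rw [map_zero] at hh'
    refine hh (((‹P.IsPrime›.mem_or_mem (hh' ▸ P.zero_mem :
      (f₁ : S) ^ N * aeval z₁ h ∈ P)).resolve_left fun h => hf₁P ?_))
    exact ‹P.IsPrime›.mem_of_pow_mem N h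
  have hwf : WellFounded (DvdNotUnit : R[X] → R[X] → Prop) := IsWellFounded.wf
  obtain ⟨k, ⟨δ, hδ, hδk, l, hδl⟩, hmin⟩ := hwf.has_min
    {k : R[X] | ∃ δ : R, IsRelPrime δ f₁ ∧ C δ * k = h' ∧ C δ ∣ g'}
    ⟨h', 1, isRelPrime_one_left, by simp, by simp⟩
  have hδ0 : δ ≠ 0 := by
    rintro rfl
    simp only [C_0, zero_mul] at hδk
    exact hh0 hδk.symm
  have hk0 : k ≠ 0 := by
    rintro rfl
    rw [mul_zero] at hδk
    exact hh0 hδk.symm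
  have hcop : CoprimeMod ((f₁ : S) ^ N) δ :=
    (hR.coprimeMod_of_isRelPrime hP hf₁ hδ0 hδ.symm).pow_left N
  have hδk' : (δ : S) * aeval z₂ k = f₁ ^ N * aeval z₁ h := by
    rw [← hh', ← hδk, map_mul, aeval_C]; rfl
  have hδl' : (δ : S) * aeval z₂ l = f₁ ^ N * aeval z₁ g := by
    rw [← hg', hδl, map_mul, aeval_C]; rfl
  obtain ⟨a, ha⟩ := hcop _ ⟨_, hδk'.symm⟩
  obtain ⟨b, hb⟩ := hcop _ ⟨_, hδl'.symm⟩
  refine ⟨δ, hδ0, a, b, ha, hb, fun J hJ hfJ hz haJ hbJ => ?_⟩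
  have hδreg := hR.mem_nonZeroDivisors hP hδ0
  have hka : aeval z₂ k = f₁ ^ N * a := by
    refine (mul_cancel_left_mem_nonZeroDivisors hδreg).1 ?_
    rw [hδk', ha]; ring
  have hlb : aeval z₂ l = f₁ ^ N * b := by
    refine (mul_cancel_left_mem_nonZeroDivisors hδreg).1 ?_
    rw [hδl', hb]; ring
  obtain ⟨r, hr, hJ⟩ := hJ
  obtain ⟨π, hπ, hπJ⟩ := hR.exists_prime_of_isAssMod hP hr hJ
  obtain ⟨k', rfl⟩ := hz.C_dvd hπJ (hka ▸ J.mul_mem_left _ haJ)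
  obtain ⟨l', rfl⟩ := hz.C_dvd hπJ (hlb ▸ J.mul_mem_left _ hbJ)
  have hπf₁ : ¬ π ∣ f₁ := fun hd => by
    have hJ' := hJ.of_mem (hR.mem_nonZeroDivisors hP hr) (hR.mem_nonZeroDivisors hP hf₂) hfJ
    exact hJ'.notMem (coprimeMod_iff.1 hf) ((hπJ _).2 hd)
  refine hmin k' ⟨δ * π, hδ.mul_left (hπ.irreducible.isRelPrime_iff_not_dvd.2 hπf₁), ?_, ?_⟩
    ⟨right_ne_zero_of_mul hk0, C π, fun hu => hπ.not_isUnit (isUnit_C.1 hu), mul_comm _ _⟩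
  · rw [← hδk, C_mul, mul_assoc]
  · rw [hδl, C_mul]
    exact ⟨l', by ring⟩

theorem exists_coprimeMod_aeval (hR : IsGoodSubring P R) (hP : ∀ s ∉ P, s ∈ nonZeroDivisors S)
    {f₁ f₂ c : R} {z₁ z₂ : S} (h12 : f₁ * z₁ + f₂ * z₂ = c)
    (hf : CoprimeMod (f₁ : S) f₂) (hf₂ : f₂ ≠ 0)
    (hz₁ : ∀ J ∈ assPrimes R, (f₂ : S) ∉ J → TransMod R J z₁)
    (hz₂ : ∀ J ∈ assPrimes R, (f₂ : S) ∈ J → TransMod R J z₂)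
    {h g : R[X]} (hrel : IsRelPrime h g) (hh : aeval z₁ h ∉ P) (hg : aeval z₁ g ∉ P) :
    ∃ δ : R, δ ≠ 0 ∧ ∃ a b : S, aeval z₁ h = δ * a ∧ aeval z₁ g = δ * b ∧ CoprimeMod a b := by
  obtain ⟨δ, hδ, a, b, ha, hb, hab⟩ := hR.exists_factor hP h12 hf hf₂ hh g
  have := hR.isDomain hP
  have := hR.uniqueFactorizationMonoid hP
  refine ⟨δ, hδ, a, b, ha, hb, ?_⟩
  rw [coprimeMod_iff]
  by_contra hcon
  obtain ⟨J, hJ, haJ⟩ := exists_isAssMod_of_not_regularMod hcon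
  have hJp := hJ.1
  have hbJ : b ∈ J := hJ.le (Ideal.mem_span_singleton_self b)
  have hbreg : b ∈ nonZeroDivisors S := hP b fun h => hg (hb ▸ P.mul_mem_left _ h)
  have hhJ : aeval z₁ h ∈ J := ha ▸ J.mul_mem_left _ haJ
  have hgJ : aeval z₁ g ∈ J := hb ▸ J.mul_mem_left _ hbJ
  have h0 : h ≠ 0 := by
    rintro rfl
    exact hh (by rw [map_zero]; exact P.zero_mem)
  obtain ⟨u, v, r, hr, huv⟩ := Polynomial.exists_mul_add_mul_eq_C h0 hrel
  have hrJ : (r : S) ∈ J := by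
    have := congrArg (aeval z₁) huv
    rw [map_add, map_mul, map_mul, aeval_C] at this
    change _ = (r : S) at this
    rw [← this]
    exact J.add_mem (J.mul_mem_left _ hhJ) (J.mul_mem_left _ hgJ)
  have hJr := hJ.of_mem hbreg (hR.mem_nonZeroDivisors hP hr) hrJ
  have hJC : J ∈ assPrimes R := ⟨r, hr, hJr⟩
  by_cases hfJ : (f₂ : S) ∈ J
  · exact hab J hJC hfJ (hz₂ J hJC hfJ) haJ hbJ
  · obtain ⟨π, hπ, hπJ⟩ := hR.exists_prime_of_isAssMod hP hr hJr
    have hz := hz₁ J hJC hfJ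
    exact hπ.not_isUnit (isUnit_C.1 (hrel (hz.C_dvd hπJ hhJ)
      (hz.C_dvd hπJ hgJ)))

/-- The subring obtained by adjoining `z` and closing up under division. -/
theorem extend (hR : IsGoodSubring P R) (hP : ∀ s ∉ P, s ∈ nonZeroDivisors S)
    {f₁ f₂ c : R} {z₁ z₂ : S} (h12 : f₁ * z₁ + f₂ * z₂ = c)
    (hf : CoprimeMod (f₁ : S) f₂) (hf₂ : f₂ ≠ 0) (hzP : TransMod R P z₁)
    (hz₁ : ∀ J ∈ assPrimes R, (f₂ : S) ∉ J → TransMod R J z₁)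
    (hz₂ : ∀ J ∈ assPrimes R, (f₂ : S) ∈ J → TransMod R J z₂) :
    IsGoodSubring P (saturation P (aeval z₁ : R[X] →ₐ[R] S).toRingHom.range) := by
  have := hR.isDomain hP
  have := hR.uniqueFactorizationMonoid hP
  have hzero : ∀ h : R[X], aeval z₁ h ∈ P → h = 0 := fun h hh => by
    ext i
    exact hR.eq_zero_of_mem _ (h.coeff i).2 (hzP h hh i)
  have hmem : ∀ h : R[X], aeval z₁ h ∈ (aeval z₁ : R[X] →ₐ[R] S).toRingHom.range :=
    fun h => ⟨h, rfl⟩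
  refine of_saturation hP ?_ ?_
  · rintro _ ⟨h, rfl⟩ hhP
    rw [hzero h hhP]
    exact map_zero _
  · rintro _ ⟨h, rfl⟩ _ ⟨g, rfl⟩ hh hg
    change aeval z₁ h ≠ 0 at hh
    change aeval z₁ g ≠ 0 at hg
    have hh0 : h ≠ 0 := by rintro rfl; exact hh (map_zero _)
    have hg0 : g ≠ 0 := by rintro rfl; exact hg (map_zero _)
    obtain ⟨h', g', d, hrel, rfl, rfl⟩ :=
      UniqueFactorizationMonoid.exists_reduced_factors h hh0 g
    have hh' : aeval z₁ h' ∉ P := fun h => right_ne_zero_of_mul hh0 (hzero _ h)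
    have hg' : aeval z₁ g' ∉ P := fun h => right_ne_zero_of_mul hg0 (hzero _ h)
    obtain ⟨δ, hδ, a, b, ha, hb, hab⟩ :=
      hR.exists_coprimeMod_aeval hP h12 hf hf₂ hz₁ hz₂ hrel hh' hg'
    have hδmem : (δ : S) ∈ (aeval z₁ : R[X] →ₐ[R] S).toRingHom.range :=
      ⟨C δ, aeval_C _ _⟩
    refine ⟨a, ⟨δ, hδmem, hR.notMem hδ, ha ▸ hmem _⟩, b, ⟨δ, hδmem, hR.notMem hδ, hb ▸ hmem _⟩,
      ?_, ?_, hab, ?_⟩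
    · rintro rfl; exact hh' (by rw [ha, mul_zero]; exact P.zero_mem)
    · rintro rfl; exact hg' (by rw [hb, mul_zero]; exact P.zero_mem)
    · change aeval z₁ (d * h') * b = aeval z₁ (d * g') * a
      rw [map_mul, map_mul, ha, hb]; ring

end IsGoodSubring

end Extension

section Expansion

variable {S : Type*} [CommRing S] [IsLocalRing S] [IsAdicComplete (maximalIdeal S) S]

theorem exists_limit {f : ℕ → S} (hf : ∀ n, f (n + 1) - f n ∈ maximalIdeal S ^ n) :
    ∃ L, ∀ n, L - f n ∈ maximalIdeal S ^ n := by
  have h : ∀ m k, f (m + k) - f m ∈ maximalIdeal S ^ m := by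
    intro m k
    induction k with
    | zero => simp
    | succ k ih =>
      have := add_mem (Ideal.pow_le_pow_right (Nat.le_add_right m k) (hf (m + k))) ih
      rwa [sub_add_sub_cancel] at this
  obtain ⟨L, hL⟩ := IsPrecomplete.prec' (I := maximalIdeal S) f (by
    intro m n hmn
    obtain ⟨k, rfl⟩ := Nat.exists_eq_add_of_le hmn
    rw [SModEq.sub_mem, smul_eq_mul, Ideal.mul_top, ← neg_sub]
    exact neg_mem (h m k))
  refine ⟨L, fun n => ?_⟩
  have := SModEq.sub_mem.1 (hL n)
  rw [smul_eq_mul, Ideal.mul_top, ← neg_sub] at this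
  simpa using neg_mem this

theorem eq_zero_of_forall_mem_pow {x : S} (h : ∀ n, x ∈ maximalIdeal S ^ n) : x = 0 :=
  IsHausdorff.haus' (I := maximalIdeal S) x fun n => by
    rw [SModEq.sub_mem, smul_eq_mul, Ideal.mul_top, sub_zero]
    exact h n

/-- Expansions in powers of `w` with digits representing elements of the residue field. -/
theorem exists_expansion {w : S} (hw : w ∈ maximalIdeal S) :
    ∃ σ : (ℕ → ResidueField S) → S, ∀ a b, a ≠ b →
      ∃ v : S, IsUnit v ∧ ∃ n, σ a - σ b = v * w ^ n := by
  obtain ⟨ρ, hρ⟩ : ∃ ρ : ResidueField S → S, ∀ x, residue S (ρ x) = x :=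
    ⟨_, Function.surjInv_eq residue_surjective⟩
  have hlim : ∀ a : ℕ → ResidueField S, ∃ L, ∀ n,
      L - ∑ i ∈ Finset.range n, ρ (a i) * w ^ i ∈ maximalIdeal S ^ n := fun a =>
    exists_limit fun n => by
      rw [Finset.sum_range_succ, add_sub_cancel_left]
      exact Ideal.mul_mem_left _ _ (Ideal.pow_mem_pow hw n)
  choose σ hσ using hlim
  have hrec : ∀ a, σ a = ρ (a 0) + w * σ (fun i => a (i + 1)) := by
    intro a
    refine sub_eq_zero.1 (eq_zero_of_forall_mem_pow fun n => ?_)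
    have h1 := Ideal.pow_le_pow_right (Nat.le_succ n) (hσ a (n + 1))
    have h2 := Ideal.mul_mem_left _ w (hσ (fun i => a (i + 1)) n)
    have := sub_mem h1 h2
    rw [Finset.sum_range_succ', mul_sub, Finset.mul_sum] at this
    convert this using 1
    have h3 : ∑ i ∈ Finset.range n, w * (ρ (a (i + 1)) * w ^ i) =
        ∑ i ∈ Finset.range n, ρ (a (i + 1)) * w ^ (i + 1) :=
      Finset.sum_congr rfl fun i _ => by ring
    rw [h3]
    ring
  refine ⟨σ, fun a b hab => ?_⟩
  obtain ⟨n, hn⟩ : ∃ n, a n ≠ b n := Function.ne_iff.1 hab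
  clear hab
  induction n generalizing a b with
  | zero =>
    refine ⟨σ a - σ b, ?_, 0, by simp⟩
    rw [← residue_ne_zero_iff_isUnit, hrec a, hrec b]
    have : residue S w = 0 := (residue_eq_zero_iff w).2 hw
    simp only [map_sub, map_add, map_mul, this, hρ, zero_mul, add_zero]
    exact sub_ne_zero.2 hn
  | succ n ih =>
    by_cases h0 : a 0 = b 0
    · obtain ⟨v, hv, m, hm⟩ := ih (fun i => a (i + 1)) (fun i => b (i + 1)) hn
      refine ⟨v, hv, m + 1, ?_⟩
      rw [hrec a, hrec b, h0]
      linear_combination w * hm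
    · refine ⟨σ a - σ b, ?_, 0, by simp⟩
      rw [← residue_ne_zero_iff_isUnit, hrec a, hrec b]
      have : residue S w = 0 := (residue_eq_zero_iff w).2 hw
      simp only [map_sub, map_add, map_mul, this, hρ, zero_mul, add_zero]
      exact sub_ne_zero.2 h0

theorem exists_expansion_sub_notMem {w : S} (hw : w ∈ maximalIdeal S) :
    ∃ σ : (ℕ → ResidueField S) → S, ∀ J : Ideal S, J.IsPrime → w ∉ J →
      ∀ a b, a ≠ b → σ a - σ b ∉ J := by
  obtain ⟨σ, hσ⟩ := exists_expansion hw
  refine ⟨σ, fun J hJ hwJ a b hab h => ?_⟩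
  obtain ⟨v, hv, n, hn⟩ := hσ a b hab
  rw [hn] at h
  rcases hJ.mem_or_mem h with h | h
  · exact hJ.ne_top (Ideal.eq_top_of_isUnit_mem _ h hv)
  · exact hwJ (hJ.mem_of_pow_mem n h)

end Expansion

section Avoidance

open Polynomial Cardinal

universe v

theorem exists_forall_notMem_of_finite {ι 𝒞 : Type v} [Infinite ι] (hlt : #𝒞 < #ι)
    {bad : 𝒞 → Set ι} (hbad : ∀ c, (bad c).Finite) : ∃ a, ∀ c, a ∉ bad c := by
  by_contra! hcon
  choose f hf using hcon
  obtain ⟨c, hc⟩ := Cardinal.exists_infinite_fiber f hlt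
  refine (Set.infinite_coe_iff.1 hc) ((hbad c).subset ?_)
  rintro a rfl
  exact hf a

variable {S : Type v} [CommRing S]

theorem finite_not_transMod {ι : Type*} {R : Subring S} {J : Ideal S} [J.IsPrime] {z : ι → S}
    (hz : ∀ a b, a ≠ b → z a - z b ∉ J) (h : R[X]) :
    {a | aeval (z a) h ∈ J ∧ ∃ i, (h.coeff i : S) ∉ J}.Finite := by
  classical
  by_cases hh : ∃ i, (h.coeff i : S) ∉ J
  swap
  · convert Set.finite_empty
    ext a
    simp [hh]
  set φ : R →+* S ⧸ J := (Ideal.Quotient.mk J).comp R.subtype with hφ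
  have h0 : h.map φ ≠ 0 := by
    obtain ⟨i, hi⟩ := hh
    intro h0
    have := congrArg (coeff · i) h0
    simp only [coeff_map, coeff_zero] at this
    exact hi (Ideal.Quotient.eq_zero_iff_mem.1 this)
  refine Set.Finite.of_finite_image (f := fun a => Ideal.Quotient.mk J (z a)) ?_ ?_
  · refine (h.map φ).roots.toFinset.finite_toSet.subset ?_
    rintro _ ⟨a, ⟨ha, -⟩, rfl⟩
    simp only [Finset.mem_coe, Multiset.mem_toFinset]
    rw [mem_roots h0, IsRoot.def, eval_map, hφ, ← hom_eval₂, Ideal.Quotient.eq_zero_iff_mem]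
    exact ha
  · intro a _ b _ hab
    by_contra hne
    exact hz a b hne (Ideal.Quotient.eq.1 hab)

theorem exists_transMod {ι : Type v} {R : Subring S} {𝒞 : Set (Ideal S)} (hι : ℵ₀ < #ι)
    (hR : #R < #ι) (h𝒞 : #𝒞 < #ι) (hp : ∀ J ∈ 𝒞, J.IsPrime) {z : Ideal S → ι → S}
    (hz : ∀ J ∈ 𝒞, ∀ a b, a ≠ b → z J a - z J b ∉ J) :
    ∃ a, ∀ J ∈ 𝒞, TransMod R J (z J a) := by
  have : Infinite ι := Cardinal.infinite_iff.2 hι.le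
  obtain ⟨a, ha⟩ := exists_forall_notMem_of_finite (ι := ι) (𝒞 := 𝒞 × R[X])
    (bad := fun c => {a | aeval (z c.1 a) c.2 ∈ c.1.1 ∧ ∃ i, (c.2.coeff i : S) ∉ c.1.1})
    (by
      rw [Cardinal.mk_prod, Cardinal.lift_id, Cardinal.lift_id]
      refine Cardinal.mul_lt_of_lt hι.le h𝒞 (Polynomial.cardinalMk_le_max.trans_lt ?_)
      exact max_lt hR hι)
    (fun c => by
      have := hp c.1 c.1.2
      exact finite_not_transMod (hz c.1 c.1.2) c.2)
  refine ⟨a, fun J hJ h hh i => ?_⟩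
  by_contra hi
  exact ha (⟨J, hJ⟩, h) ⟨hh, i, hi⟩

theorem mk_assPrimes_le [IsNoetherianRing S] (R : Subring S) :
    #(assPrimes R) ≤ max #R ℵ₀ := by
  have h : assPrimes R ⊆ ⋃ r : R, {J | IsAssMod (Ideal.span {(r : S)}) J} := by
    rintro J ⟨r, -, hJ⟩
    exact Set.mem_iUnion.2 ⟨r, hJ⟩
  refine (Cardinal.mk_le_mk_of_subset h).trans ((Cardinal.mk_iUnion_le _).trans ?_)
  have h2 : ⨆ r : R, #{J | IsAssMod (Ideal.span {(r : S)}) J} ≤ ℵ₀ :=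
    ciSup_le' fun r => (finite_isAssMod (Ideal.span {(r : S)})).countable.le_aleph0
  exact Cardinal.mul_le_of_le (le_max_right _ _) (le_max_left _ _) (h2.trans (le_max_right _ _))

theorem mk_saturation_le {P : Ideal S} [P.IsPrime] (hP : ∀ s ∉ P, s ∈ nonZeroDivisors S)
    (R : Subring S) : #(saturation P R) ≤ #R * #R := by
  have h : ∀ s : saturation P R, ∃ x : R × R, (x.1 : S) ∉ P ∧ (x.1 : S) * s = x.2 := by
    rintro ⟨s, r, hr, hrP, hrs⟩
    exact ⟨(⟨r, hr⟩, ⟨r * s, hrs⟩), hrP, rfl⟩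
  choose f hf using h
  have hinj : Function.Injective f := fun s t hst => Subtype.ext <| by
    refine (mul_cancel_left_mem_nonZeroDivisors (hP _ (hf s).1)).1 ?_
    rw [(hf s).2, hst, (hf t).2]
  simpa using Cardinal.mk_le_of_injective hinj

theorem mk_extend_le {P : Ideal S} [P.IsPrime] (hP : ∀ s ∉ P, s ∈ nonZeroDivisors S)
    (R : Subring S) (z : S) :
    #(saturation P (aeval z : R[X] →ₐ[R] S).toRingHom.range) ≤ max #R ℵ₀ := by
  have h : #((aeval z : R[X] →ₐ[R] S).toRingHom.range) ≤ max #R ℵ₀ :=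
    (Cardinal.mk_le_of_surjective
      (aeval z : R[X] →ₐ[R] S).toRingHom.rangeRestrict_surjective).trans
      Polynomial.cardinalMk_le_max
  exact (mk_saturation_le hP _).trans (Cardinal.mul_le_of_le (le_max_right _ _) h h)

theorem le_extend (P : Ideal S) [P.IsPrime] (R : Subring S) (z : S) :
    R ≤ saturation P (aeval z : R[X] →ₐ[R] S).toRingHom.range := fun r hr =>
  le_saturation _ _ ⟨C ⟨r, hr⟩, aeval_C _ _⟩

theorem mem_extend (P : Ideal S) [P.IsPrime] (R : Subring S) (z : S) :
    z ∈ saturation P (aeval z : R[X] →ₐ[R] S).toRingHom.range :=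
  le_saturation _ _ ⟨X, aeval_X _⟩

end Avoidance

section Step

open Polynomial Cardinal

universe v

theorem aleph0_lt_mk_nat_arrow (k : Type v) [Nontrivial k] : ℵ₀ < #(ℕ → k) := by
  have h2 : (2 : Cardinal.{v}) ≤ #k := by
    rw [Cardinal.two_le_iff]
    exact exists_pair_ne k
  have h := (Cardinal.cantor ℵ₀).trans_le (Cardinal.power_le_power_right (c := ℵ₀) h2)
  simpa using h

variable {S : Type v} [CommRing S]

theorem isPrime_of_mem_insert_assPrimes {P : Ideal S} [hP : P.IsPrime] {R : Subring S}
    {J : Ideal S} (hJ : J ∈ insert P (assPrimes R)) : J.IsPrime := by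
  rcases hJ with rfl | ⟨r, -, hJ⟩
  · exact hP
  · exact hJ.1

variable {P : Ideal S} {R : Subring S}

theorem IsGoodSubring.notMem_of_coprimeMod (hR : IsGoodSubring P R)
    (hP : ∀ s ∉ P, s ∈ nonZeroDivisors S) {f₁ : S} {f₂ : R} (hf : CoprimeMod f₁ f₂) (hf₂ : f₂ ≠ 0)
    {J : Ideal S} (hJ : J ∈ assPrimes R) (hfJ : (f₂ : S) ∈ J) : f₁ ∉ J := by
  obtain ⟨r, hr, hJ⟩ := hJ
  exact (hJ.of_mem (hR.mem_nonZeroDivisors hP hr) (hR.mem_nonZeroDivisors hP hf₂) hfJ).notMem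
    (coprimeMod_iff.1 hf)

variable [IsLocalRing S] [IsNoetherianRing S]

theorem mk_insert_assPrimes_lt (hcard : #R < #(ℕ → ResidueField S)) :
    #(insert P (assPrimes R) : Set (Ideal S)) < #(ℕ → ResidueField S) := by
  have h0 := aleph0_lt_mk_nat_arrow (ResidueField S)
  exact Cardinal.mk_insert_le.trans_lt (Cardinal.add_one_lt_of_lt h0.le
    ((mk_assPrimes_le R).trans_lt (max_lt hcard h0)))

namespace IsGoodSubring

variable [P.IsPrime]

theorem exists_extend_of_notMem (hR : IsGoodSubring P R) (hP : ∀ s ∉ P, s ∈ nonZeroDivisors S)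
    (hcard : #R < #(ℕ → ResidueField S)) {σ : (ℕ → ResidueField S) → S}
    (hσ : ∀ J ∈ insert P (assPrimes R), ∀ a b, a ≠ b → σ a - σ b ∉ J) (t : S) {w : S}
    (hw : ∀ J ∈ insert P (assPrimes R), w ∉ J) :
    ∃ R', IsGoodSubring P R' ∧ R ≤ R' ∧ #R' ≤ max #R ℵ₀ ∧ ∃ z ∈ R', w ∣ z - t ∧
      z ≠ 0 ∧ ∀ r : R, r ≠ 0 → CoprimeMod z (r : S) := by
  obtain ⟨a, ha⟩ := exists_transMod (aleph0_lt_mk_nat_arrow (ResidueField S)) hcard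
    (mk_insert_assPrimes_lt (P := P) hcard) (fun J hJ => isPrime_of_mem_insert_assPrimes hJ)
    (z := fun _ a => t + w * σ a) (by
      intro J hJ a b hab h
      rw [add_sub_add_left_eq_sub, ← mul_sub] at h
      exact ((isPrime_of_mem_insert_assPrimes hJ).mem_or_mem h).elim (hw J hJ) (hσ J hJ a b hab))
  have hX : ∀ J ∈ insert P (assPrimes R), t + w * σ a ∉ J := fun J hJ h => by
    have h1 := ha J hJ X (by rwa [aeval_X]) 1
    rw [coeff_X_one] at h1
    exact (isPrime_of_mem_insert_assPrimes hJ).ne_top ((Ideal.eq_top_iff_one J).2 h1)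
  have hdom := hR.isDomain hP
  refine ⟨_, hR.extend hP (f₁ := 0) (f₂ := 1) (c := 0) (z₁ := t + w * σ a) (z₂ := 0) (by simp)
    (fun x _ => one_dvd x) one_ne_zero (ha P (Set.mem_insert _ _))
    (fun J hJ _ => ha J (Set.mem_insert_of_mem _ hJ)) (fun J hJ h1 => ?_),
    le_extend _ _ _, mk_extend_le hP _ _, _, mem_extend _ _ _, ⟨σ a, by ring⟩, ?_, ?_⟩
  · exact absurd ((Ideal.eq_top_iff_one J).2 h1)
      (isPrime_of_mem_insert_assPrimes (Set.mem_insert_of_mem P hJ)).ne_top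
  · intro h
    exact hX P (Set.mem_insert _ _) (h ▸ P.zero_mem)
  · intro r hr
    rw [coprimeMod_iff]
    by_contra hcon
    obtain ⟨J, hJ, hzJ⟩ := exists_isAssMod_of_not_regularMod hcon
    exact hX J (Set.mem_insert_of_mem _ ⟨r, hr, hJ⟩) hzJ

variable [IsAdicComplete (maximalIdeal S) S]

theorem exists_notMem_assPrimes (hR : IsGoodSubring P R) (hP : ∀ s ∉ P, s ∈ nonZeroDivisors S)
    (hcard : #R < #(ℕ → ResidueField S)) {x u : S} (hx : x ∈ maximalIdeal S) (hxP : x ∉ P)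
    (hu : u ∈ maximalIdeal S) (hux : CoprimeMod u x) :
    ∃ w ∈ maximalIdeal S, ∀ J ∈ insert P (assPrimes R), w ∉ J := by
  have h0 := aleph0_lt_mk_nat_arrow (ResidueField S)
  have : Infinite (ℕ → ResidueField S) := Cardinal.infinite_iff.2 h0.le
  obtain ⟨α, hα⟩ := exists_expansion_sub_notMem hx
  obtain ⟨a, ha⟩ := exists_forall_notMem_of_finite (ι := ℕ → ResidueField S)
    (mk_insert_assPrimes_lt (P := P) hcard)
    (bad := fun J : (insert P (assPrimes R) : Set (Ideal S)) => {a | u + α a * x ∈ J.1}) (by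
      rintro ⟨J, hJ⟩
      have hJp := isPrime_of_mem_insert_assPrimes hJ
      by_cases hxJ : x ∈ J
      · convert Set.finite_empty
        refine Set.eq_empty_iff_forall_notMem.2 fun a ha => ?_
        have huJ : u ∈ J := (Submodule.add_mem_iff_left J (J.mul_mem_left _ hxJ)).1 ha
        rcases hJ with rfl | ⟨r, hr, hJ⟩
        · exact hxP hxJ
        · exact (hJ.of_mem (hR.mem_nonZeroDivisors hP hr) (hP x hxP) hxJ).notMem
            (coprimeMod_iff.1 hux) huJ
      · refine Set.Subsingleton.finite fun a ha b hb => ?_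
        by_contra hab
        have := J.sub_mem ha hb
        rw [add_sub_add_left_eq_sub, ← sub_mul] at this
        exact (hJp.mem_or_mem this).elim (hα J hJp hxJ a b hab) hxJ)
  refine ⟨u + α a * x, add_mem hu (Ideal.mul_mem_left _ _ hx), fun J hJ => ha ⟨J, hJ⟩⟩

theorem exists_extend_approx (hR : IsGoodSubring P R) (hP : ∀ s ∉ P, s ∈ nonZeroDivisors S)
    (hcard : #R < #(ℕ → ResidueField S)) {x u : S} (hx : x ∈ maximalIdeal S) (hxP : x ∉ P)
    (hu : u ∈ maximalIdeal S) (hux : CoprimeMod u x) {f₁ f₂ : R} (hf : CoprimeMod (f₁ : S) f₂)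
    (hf₂ : f₂ ≠ 0) (t : S) :
    ∃ R', IsGoodSubring P R' ∧ R ≤ R' ∧ #R' ≤ max #R ℵ₀ ∧
      ∃ z ∈ R', z - t ∈ Ideal.span {(f₁ : S), (f₂ : S)} := by
  obtain ⟨w, hw, hwJ⟩ := hR.exists_notMem_assPrimes hP hcard hx hxP hu hux
  obtain ⟨σ, hσ⟩ := exists_expansion_sub_notMem hw
  have hσ' : ∀ J ∈ insert P (assPrimes R), ∀ a b, a ≠ b → σ a - σ b ∉ J := fun J hJ =>
    hσ J (isPrime_of_mem_insert_assPrimes hJ) (hwJ J hJ)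
  have h0 := aleph0_lt_mk_nat_arrow (ResidueField S)
  have : Infinite (ℕ → ResidueField S) := Cardinal.infinite_iff.2 h0.le
  obtain ⟨a, ha⟩ := exists_forall_notMem_of_finite (ι := ℕ → ResidueField S)
    (mk_insert_assPrimes_lt (P := P) hcard)
    (bad := fun J : (insert P (assPrimes R) : Set (Ideal S)) => {a | f₁ + σ a * f₂ ∈ J.1}) (by
      rintro ⟨J, hJ⟩
      have hJp := isPrime_of_mem_insert_assPrimes hJ
      by_cases hfJ : (f₂ : S) ∈ J
      · convert Set.finite_empty
        refine Set.eq_empty_iff_forall_notMem.2 fun a ha => ?_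
        have hf₁J : (f₁ : S) ∈ J :=
          (Submodule.add_mem_iff_left J (J.mul_mem_left _ hfJ)).1 ha
        rcases hJ with rfl | hJ
        · exact hR.notMem hf₂ hfJ
        · exact hR.notMem_of_coprimeMod hP hf hf₂ hJ hfJ hf₁J
      · refine Set.Subsingleton.finite fun a ha b hb => ?_
        by_contra hab
        have := J.sub_mem ha hb
        rw [add_sub_add_left_eq_sub, ← sub_mul] at this
        exact (hJp.mem_or_mem this).elim (hσ' J hJ a b hab) hfJ)
  obtain ⟨R', h1, h2, h3, z, hz, hzt, -⟩ := hR.exists_extend_of_notMem hP hcard hσ' t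
    (w := f₁ + σ a * f₂) fun J hJ => ha ⟨J, hJ⟩
  refine ⟨R', h1, h2, h3, z, hz, Ideal.mem_of_dvd _ hzt (Ideal.add_mem _ ?_ ?_)⟩
  · exact Ideal.subset_span (by simp)
  · exact Ideal.mul_mem_left _ _ (Ideal.subset_span (by simp))

theorem exists_extend_solve (hR : IsGoodSubring P R) (hP : ∀ s ∉ P, s ∈ nonZeroDivisors S)
    (hcard : #R < #(ℕ → ResidueField S)) {x u : S} (hx : x ∈ maximalIdeal S) (hxP : x ∉ P)
    (hu : u ∈ maximalIdeal S) (hux : CoprimeMod u x) {f₁ f₂ : R} (hf : CoprimeMod (f₁ : S) f₂)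
    (hf₂ : f₂ ≠ 0) {c : R} (hc : (c : S) ∈ Ideal.span {(f₁ : S), (f₂ : S)}) :
    ∃ R', IsGoodSubring P R' ∧ R ≤ R' ∧ #R' ≤ max #R ℵ₀ ∧
      ∃ z ∈ R', (f₂ : S) ∣ c - f₁ * z := by
  obtain ⟨w, hw, hwJ⟩ := hR.exists_notMem_assPrimes hP hcard hx hxP hu hux
  obtain ⟨σ, hσ⟩ := exists_expansion_sub_notMem hw
  have hσ' : ∀ J ∈ insert P (assPrimes R), ∀ a b, a ≠ b → σ a - σ b ∉ J := fun J hJ =>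
    hσ J (isPrime_of_mem_insert_assPrimes hJ) (hwJ J hJ)
  obtain ⟨s₁, s₂, hs⟩ := Ideal.mem_span_pair.1 hc
  classical
  obtain ⟨a, ha⟩ := exists_transMod (aleph0_lt_mk_nat_arrow (ResidueField S)) hcard
    (mk_insert_assPrimes_lt (P := P) hcard) (fun J hJ => isPrime_of_mem_insert_assPrimes hJ)
    (z := fun J a => if (f₂ : S) ∈ J then s₂ - f₁ * σ a else s₁ + f₂ * σ a) (by
      intro J hJ a b hab h
      have hJp := isPrime_of_mem_insert_assPrimes hJ
      split_ifs at h with hfJ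
      · have hf₁J : (f₁ : S) ∉ J := by
          rcases hJ with rfl | hJ
          · exact absurd hfJ (hR.notMem hf₂)
          · exact hR.notMem_of_coprimeMod hP hf hf₂ hJ hfJ
        rw [sub_sub_sub_cancel_left, ← mul_sub] at h
        exact (hJp.mem_or_mem h).elim hf₁J (hσ' J hJ b a hab.symm)
      · rw [add_sub_add_left_eq_sub, ← mul_sub] at h
        exact (hJp.mem_or_mem h).elim hfJ (hσ' J hJ a b hab))
  have h12 : (f₁ : S) * (s₁ + f₂ * σ a) + f₂ * (s₂ - f₁ * σ a) = c := by
    rw [← hs]; ring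
  refine ⟨_, hR.extend hP h12 hf hf₂ ?_ (fun J hJ hfJ => ?_) (fun J hJ hfJ => ?_),
    le_extend _ _ _, mk_extend_le hP _ _, _, mem_extend _ _ _, ⟨s₂ - f₁ * σ a, ?_⟩⟩
  · simpa only [if_neg (hR.notMem hf₂)] using ha P (Set.mem_insert _ _)
  · simpa only [if_neg hfJ] using ha J (Set.mem_insert_of_mem _ hJ)
  · simpa only [if_pos hfJ] using ha J (Set.mem_insert_of_mem _ hJ)
  · rw [← h12]; ring

theorem exists_extend_coprime (hR : IsGoodSubring P R) (hP : ∀ s ∉ P, s ∈ nonZeroDivisors S)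
    (hcard : #R < #(ℕ → ResidueField S)) {x u : S} (hx : x ∈ maximalIdeal S) (hxP : x ∉ P)
    (hu : u ∈ maximalIdeal S) (hux : CoprimeMod u x) :
    ∃ R', IsGoodSubring P R' ∧ R ≤ R' ∧ #R' ≤ max #R ℵ₀ ∧
      ∃ z ∈ R', z ∈ maximalIdeal S ∧ z ≠ 0 ∧ ∀ r : R, r ≠ 0 → CoprimeMod z (r : S) := by
  obtain ⟨w, hw, hwJ⟩ := hR.exists_notMem_assPrimes hP hcard hx hxP hu hux
  obtain ⟨σ, hσ⟩ := exists_expansion_sub_notMem hw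
  obtain ⟨R', h1, h2, h3, z, hz, hzt, h4⟩ := hR.exists_extend_of_notMem hP hcard
    (fun J hJ => hσ J (isPrime_of_mem_insert_assPrimes hJ) (hwJ J hJ)) 0 hwJ
  rw [sub_zero] at hzt
  exact ⟨R', h1, h2, h3, z, hz, Ideal.mem_of_dvd _ hzt hw, h4⟩

end IsGoodSubring

end Step

section TransfiniteUnion

open Cardinal

universe v

theorem mk_iSup_subring_le {S : Type v} [Ring S] {ι : Type v} [Nonempty ι] {F : ι → Subring S}
    (hF : Directed (· ≤ ·) F) {μ : Cardinal.{v}} (hμ : ℵ₀ ≤ μ) (hι : #ι ≤ μ)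
    (h : ∀ i, #(F i) ≤ μ) : #(⨆ i, F i : Subring S) ≤ μ := by
  have h1 : #(⨆ i, F i : Subring S) = #(⋃ i, (F i : Set S) : Set S) := by
    rw [← Subring.coe_iSup_of_directed hF]
    rfl
  rw [h1]
  exact (Cardinal.mk_iUnion_le _).trans (Cardinal.mul_le_of_le hμ hι (ciSup_le' h))

/-- Every value of the second projection of a bijection `W ≃ W × τ` is attained cofinally. -/
theorem exists_cofinal_tasks {κ : Cardinal.{v}} (hκ : ℵ₀ < κ) {τ : Type v} [Nonempty τ]
    (hτ : #τ ≤ κ) :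
    ∃ task : κ.ord.ToType → τ, ∀ γ t, ∃ β, γ < β ∧ task β = t := by
  have hW : #κ.ord.ToType = κ := Cardinal.mk_ord_toType κ
  have hcard : #κ.ord.ToType = #(κ.ord.ToType × τ) := by
    rw [Cardinal.mk_prod, Cardinal.lift_id, Cardinal.lift_id, hW,
      Cardinal.mul_eq_left hκ.le hτ (Cardinal.mk_ne_zero τ)]
  obtain ⟨e⟩ := Cardinal.eq.1 hcard
  refine ⟨fun β => (e β).2, fun γ t => ?_⟩
  by_contra! hcon
  have hle : #κ.ord.ToType ≤ #(Set.Iic γ) := by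
    refine Cardinal.mk_le_of_injective (f := fun w => ⟨e.symm (w, t), ?_⟩) ?_
    · by_contra hlt
      exact hcon _ (not_le.1 hlt) (by simp)
    · intro a b hab
      simpa using hab
  refine hle.not_gt (Cardinal.mk_Iic_lt γ ?_ (by rw [hW]; exact hκ.le))
  rw [hW, Ordinal.type_toType]

theorem exists_transfinite_union {S : Type v} [Ring S] {κ : Cardinal.{v}} (hκ : ℵ₀ < κ)
    {τ : Type v} [Nonempty τ] (hτ : #τ ≤ κ) {𝒢 : Subring S → Prop}
    (h𝒢 : ∀ {ι : Type v} [Nonempty ι] (F : ι → Subring S), Directed (· ≤ ·) F →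
      (∀ i, 𝒢 (F i)) → 𝒢 (⨆ i, F i))
    {D : τ → Subring S → Subring S → Prop}
    (step : ∀ t R, 𝒢 R → #R < κ → ∃ R', 𝒢 R' ∧ R ≤ R' ∧ #R' ≤ max #R ℵ₀ ∧ D t R R')
    {R₀ : Subring S} (hR₀ : 𝒢 R₀) (hcard : #R₀ ≤ ℵ₀) :
    ∃ A, 𝒢 A ∧ R₀ ≤ A ∧ ∀ t, ∀ a ∈ A, ∀ b ∈ A, ∀ c ∈ A, ∃ R R', a ∈ R ∧ b ∈ R ∧ c ∈ R ∧
      R' ≤ A ∧ D t R R' := by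
  classical
  obtain ⟨task, htask⟩ := exists_cofinal_tasks hκ hτ
  have step' : ∀ t R, ∃ R', R ≤ R' ∧
      (𝒢 R → #R < κ → 𝒢 R' ∧ #R' ≤ max #R ℵ₀ ∧ D t R R') := by
    intro t R
    by_cases h : 𝒢 R ∧ #R < κ
    · obtain ⟨R', h1, h2, h3⟩ := step t R h.1 h.2
      exact ⟨R', h2, fun _ _ => ⟨h1, h3⟩⟩
    · exact ⟨R, le_rfl, fun h1 h2 => absurd ⟨h1, h2⟩ h⟩
  choose g hle hg using step'
  let V (β : κ.ord.ToType) (F : ∀ γ, γ < β → Subring S) (o : Option (Set.Iio β)) : Subring S :=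
    o.elim R₀ fun γ => F γ.1 γ.2
  let F : κ.ord.ToType → Subring S :=
    (wellFounded_lt (α := κ.ord.ToType)).fix fun β F => g (task β) (⨆ o, V β F o)
  let U (β : κ.ord.ToType) : Subring S := ⨆ o, V β (fun γ _ => F γ) o
  have hF : ∀ β, F β = g (task β) (U β) := fun β =>
    (wellFounded_lt (α := κ.ord.ToType)).fix_eq _ β
  have hUF : ∀ β, U β ≤ F β := fun β => hF β ▸ hle _ _
  have hRU : ∀ β, R₀ ≤ U β := fun β => le_iSup (V β fun γ _ => F γ) none
  have hFU : ∀ γ β, γ < β → F γ ≤ U β := fun γ β h =>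
    le_iSup (V β fun γ _ => F γ) (some ⟨γ, h⟩)
  have hmono : Monotone F := by
    intro γ β h
    rcases h.eq_or_lt with rfl | h
    · exact le_rfl
    · exact (hFU γ β h).trans (hUF β)
  have hdir : ∀ β, Directed (· ≤ ·) (V β fun γ _ => F γ) := by
    rintro β (_ | γ) (_ | δ)
    · exact ⟨none, le_rfl, le_rfl⟩
    · exact ⟨some δ, (hRU _).trans (hUF _), le_rfl⟩
    · exact ⟨some γ, le_rfl, (hRU _).trans (hUF _)⟩
    · rcases le_total γ δ with h | h
      · exact ⟨some δ, hmono h, le_rfl⟩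
      · exact ⟨some γ, le_rfl, hmono h⟩
  have hsmall : ∀ β : κ.ord.ToType, max ℵ₀ #(Set.Iio β) < κ := fun β =>
    max_lt hκ ((Cardinal.mk_Iio_lt β (by rw [Cardinal.mk_ord_toType, Ordinal.type_toType])).trans_eq
      (Cardinal.mk_ord_toType κ))
  have hU : ∀ β, (∀ γ, γ < β → 𝒢 (F γ) ∧ #(F γ) ≤ max ℵ₀ #(Set.Iio γ)) →
      𝒢 (U β) ∧ #(U β) ≤ max ℵ₀ #(Set.Iio β) := by
    intro β ih
    constructor
    · refine h𝒢 _ (hdir β) ?_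
      rintro (_ | γ)
      · exact hR₀
      · exact (ih γ.1 γ.2).1
    · refine mk_iSup_subring_le (hdir β) (le_max_left _ _) ?_ ?_
      · rw [Cardinal.mk_option]
        exact Cardinal.add_le_of_le (le_max_left _ _) (le_max_right _ _)
          (Cardinal.one_le_aleph0.trans (le_max_left _ _))
      · rintro (_ | γ)
        · exact hcard.trans (le_max_left _ _)
        · exact (ih γ.1 γ.2).2.trans (max_le_max le_rfl
            (Cardinal.mk_le_mk_of_subset (Set.Iio_subset_Iio (le_of_lt γ.2))))
  have hmain : ∀ β, 𝒢 (F β) ∧ #(F β) ≤ max ℵ₀ #(Set.Iio β) := by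
    intro β
    induction β using (wellFounded_lt (α := κ.ord.ToType)).induction with
    | _ β ih =>
      obtain ⟨h1, h2⟩ := hU β ih
      obtain ⟨h3, h4, -⟩ := hg (task β) (U β) h1 (h2.trans_lt (hsmall β))
      rw [hF β]
      exact ⟨h3, h4.trans (max_le h2 (le_max_left _ _))⟩
  have : Nonempty κ.ord.ToType := by
    rw [← Cardinal.mk_ne_zero_iff, Cardinal.mk_ord_toType]
    exact (Cardinal.aleph0_pos.trans hκ).ne'
  have hdirF : Directed (· ≤ ·) F := hmono.directed_le
  refine ⟨⨆ β, F β, h𝒢 F hdirF fun β => (hmain β).1, ?_, ?_⟩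
  · obtain ⟨β⟩ := this
    exact ((hRU β).trans (hUF β)).trans (le_iSup F β)
  · intro t a ha b hb c hc
    rw [Subring.mem_iSup_of_directed hdirF] at ha hb hc
    obtain ⟨i, hi⟩ := ha
    obtain ⟨j, hj⟩ := hb
    obtain ⟨k, hk⟩ := hc
    obtain ⟨β, hβ, rfl⟩ := htask (max i (max j k)) t
    obtain ⟨h1, h2⟩ := hU β fun γ _ => hmain γ
    refine ⟨U β, F β, hFU i β ?_ hi, hFU j β ?_ hj, hFU k β ?_ hk, le_iSup F β, ?_⟩
    · exact (le_max_left _ _).trans_lt hβ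
    · exact ((le_max_left _ _).trans (le_max_right _ _)).trans_lt hβ
    · exact ((le_max_right _ _).trans (le_max_right _ _)).trans_lt hβ
    · rw [hF β]
      exact (hg (task β) (U β) h1 (h2.trans_lt (hsmall β))).2.2

theorem IsGoodSubring.iSup {S : Type v} [CommRing S] {P : Ideal S} {ι : Type*} [Nonempty ι]
    {F : ι → Subring S} (hF : Directed (· ≤ ·) F) (h : ∀ i, IsGoodSubring P (F i)) :
    IsGoodSubring P (⨆ i, F i) := by
  have hmem : ∀ {x}, x ∈ ⨆ i, F i ↔ ∃ i, x ∈ F i := Subring.mem_iSup_of_directed hF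
  refine ⟨fun r hr hrP => ?_, fun r hr h0 s hs => ?_, fun a ha b hb ha0 hb0 => ?_⟩
  · obtain ⟨i, hi⟩ := hmem.1 hr
    exact (h i).eq_zero_of_mem r hi hrP
  · obtain ⟨i, hi⟩ := hmem.1 hr
    obtain ⟨j, hj⟩ := hmem.1 hs
    obtain ⟨k, hik, hjk⟩ := hF i j
    exact hmem.2 ⟨k, (h k).mem_of_mul_mem r (hik hi) h0 s (hjk hj)⟩
  · obtain ⟨i, hi⟩ := hmem.1 ha
    obtain ⟨j, hj⟩ := hmem.1 hb
    obtain ⟨k, hik, hjk⟩ := hF i j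
    obtain ⟨a', ha', b', hb', h'⟩ := (h k).exists_coprimeMod a (hik hi) b (hjk hj) ha0 hb0
    exact ⟨a', hmem.2 ⟨k, ha'⟩, b', hmem.2 ⟨k, hb'⟩, h'⟩

theorem isGoodSubring_bot {S : Type v} [CommRing S] {P : Ideal S} (hP : P ≠ ⊤) (p : ℕ)
    [Fact p.Prime] [CharP S p] : IsGoodSubring P (⊥ : Subring S) := by
  have hunit : ∀ r ∈ (⊥ : Subring S), r ≠ 0 → ∃ s ∈ (⊥ : Subring S), r * s = 1 := by
    intro r hr h0
    obtain ⟨n, rfl⟩ := Subring.mem_bot.1 hr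
    have hn : (n : ZMod p) ≠ 0 := by
      rwa [Ne, CharP.intCast_eq_zero_iff (ZMod p) p, ← CharP.intCast_eq_zero_iff S p]
    refine ⟨ZMod.castHom dvd_rfl S ((n : ZMod p)⁻¹), ?_, ?_⟩
    · obtain ⟨m, hm⟩ := ZMod.intCast_surjective ((n : ZMod p)⁻¹)
      rw [← hm, map_intCast]
      exact Subring.mem_bot.2 ⟨m, rfl⟩
    · rw [← map_intCast (ZMod.castHom dvd_rfl S : ZMod p →+* S) n, ← map_mul, mul_inv_cancel₀ hn,
        map_one]
  refine ⟨fun r hr hrP => ?_, fun r hr h0 s hs => ?_, fun a ha b hb ha0 hb0 => ?_⟩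
  · by_contra h0
    obtain ⟨s, -, hs⟩ := hunit r hr h0
    exact hP ((Ideal.eq_top_iff_one P).2 (hs ▸ P.mul_mem_right s hrP))
  · obtain ⟨t, ht, hrt⟩ := hunit r hr h0
    have : s = t * (r * s) := by linear_combination -s * hrt
    rw [this]
    exact mul_mem ht hs
  · obtain ⟨t, ht, hbt⟩ := hunit b hb hb0
    have h1 : (1 : S) ≠ 0 := fun h => hP ((Ideal.eq_top_iff_one P).2 (h ▸ P.zero_mem))
    refine ⟨t * a, mul_mem ht ha, 1, one_mem _, fun h => ha0 ?_, h1, fun x _ => one_dvd x, ?_⟩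
    · linear_combination b * h - a * hbt
    · linear_combination -a * hbt

end TransfiniteUnion

section CompleteCardinality

open Cardinal

universe v

theorem mk_nat_arrow_power_aleph0 (k : Type v) : #(ℕ → k) ^ (ℵ₀ : Cardinal.{v}) = #(ℕ → k) := by
  simp [← Cardinal.power_mul]

variable {S : Type v} [CommRing S] [IsLocalRing S] [IsNoetherianRing S]

theorem exists_residues_pow (n : ℕ) :
    ∃ Z : Set S, #Z ≤ #(ℕ → ResidueField S) ∧ ∀ s, ∃ z ∈ Z, s - z ∈ maximalIdeal S ^ n := by
  set κ := #(ℕ → ResidueField S) with hκ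
  have h0 : ℵ₀ < κ := aleph0_lt_mk_nat_arrow (ResidueField S)
  induction n with
  | zero => exact ⟨{0}, by simpa using Cardinal.one_le_aleph0.trans h0.le, by simp⟩
  | succ n ih =>
    obtain ⟨Z, hZ, hZm⟩ := ih
    obtain ⟨G, hG⟩ := (IsNoetherian.noetherian (maximalIdeal S ^ n) : (maximalIdeal S ^ n).FG)
    choose lift hlift using (residue_surjective (R := S))
    refine ⟨Set.range fun w : Z × (G → ResidueField S) => w.1.1 + ∑ g, lift (w.2 g) * g.1, ?_,
      fun s => ?_⟩
    · refine Cardinal.mk_range_le.trans ?_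
      rw [Cardinal.mk_prod, Cardinal.lift_id, Cardinal.lift_id]
      refine Cardinal.mul_le_of_le h0.le hZ ?_
      have hk : #(ResidueField S) ≤ κ :=
        Cardinal.mk_le_of_injective (f := fun a _ => a) fun a b h => congrFun h 0
      rw [← Cardinal.power_def, hκ, ← mk_nat_arrow_power_aleph0]
      exact (Cardinal.power_le_power_right hk).trans (Cardinal.power_le_power_left
        (Cardinal.aleph0_pos.trans h0).ne' (Cardinal.lt_aleph0_of_finite G).le)
    · obtain ⟨z, hz, hsz⟩ := hZm s
      rw [← hG] at hsz
      obtain ⟨c, hc⟩ := Submodule.mem_span_finset'.1 hsz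
      refine ⟨_, ⟨⟨⟨z, hz⟩, fun g => residue S (c g)⟩, rfl⟩, ?_⟩
      have : s - (z + ∑ g, lift (residue S (c g)) * g.1) =
          ∑ g, (c g - lift (residue S (c g))) * g.1 := by
        simp only [sub_mul, Finset.sum_sub_distrib]
        simp only [smul_eq_mul] at hc
        linear_combination -hc
      change s - (z + ∑ g, lift (residue S (c g)) * g.1) ∈ _
      rw [this, pow_succ']
      refine Ideal.sum_mem _ fun g _ => Ideal.mul_mem_mul ?_ (hG ▸ Ideal.subset_span g.2)
      rw [← residue_eq_zero_iff, map_sub, hlift, sub_self]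

theorem mk_le_mk_nat_arrow_residueField [IsAdicComplete (maximalIdeal S) S] :
    #S ≤ #(ℕ → ResidueField S) := by
  choose Z hZ z hzZ hz using fun n => exists_residues_pow (S := S) n
  have hinj : Function.Injective fun (s : S) (n : ℕ) => (⟨z n s, hzZ n s⟩ : Z n) := by
    intro a b hab
    rw [← sub_eq_zero]
    refine eq_zero_of_forall_mem_pow fun n => ?_
    have h1 : z n a = z n b := congrArg Subtype.val (congrFun hab n)
    have := sub_mem (hz n a) (hz n b)
    rwa [h1, sub_sub_sub_cancel_right] at this
  refine (Cardinal.mk_le_of_injective hinj).trans ?_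
  rw [Cardinal.mk_pi, ← mk_nat_arrow_power_aleph0]
  refine (Cardinal.prod_le_prod _ _ hZ).trans ?_
  rw [Cardinal.prod_const]
  simp

end CompleteCardinality

section Precompletion

open Cardinal

universe v

variable {S : Type v} [CommRing S]

/-- A good subring closed under approximation modulo coprime pairs and under solving linear
equations over coprime pairs. -/
structure IsClosedSubring (P : Ideal S) [IsLocalRing S] (A : Subring S) : Prop
    extends IsGoodSubring P A where
  exists_pair : ∃ f₁ f₂ : A, (f₁ : S) ∈ maximalIdeal S ∧ (f₂ : S) ∈ maximalIdeal S ∧ f₁ ≠ 0 ∧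
    f₂ ≠ 0 ∧ CoprimeMod (f₁ : S) f₂
  approx : ∀ f₁ f₂ : A, CoprimeMod (f₁ : S) f₂ → f₂ ≠ 0 → ∀ t : S,
    ∃ z : A, (z : S) - t ∈ Ideal.span {(f₁ : S), (f₂ : S)}
  solve : ∀ f₁ f₂ c : A, CoprimeMod (f₁ : S) f₂ → f₂ ≠ 0 →
    (c : S) ∈ Ideal.span {(f₁ : S), (f₂ : S)} → ∃ z : A, (f₂ : S) ∣ c - f₁ * z

variable [IsLocalRing S] [IsNoetherianRing S] [IsAdicComplete (maximalIdeal S) S]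
  {P : Ideal S} [P.IsPrime]

theorem IsGoodSubring.exists_extend_step {R : Subring S} (hR : IsGoodSubring P R)
    (hP : ∀ s ∉ P, s ∈ nonZeroDivisors S) (hcard : #R < #(ℕ → ResidueField S)) {x u : S}
    (hx : x ∈ maximalIdeal S) (hxP : x ∉ P) (hu : u ∈ maximalIdeal S) (hux : CoprimeMod u x)
    (f₁ f₂ c t : S) :
    ∃ R', IsGoodSubring P R' ∧ R ≤ R' ∧ #R' ≤ max #R ℵ₀ ∧
      (f₁ ∈ R → f₂ ∈ R → c ∈ R → CoprimeMod f₁ f₂ → f₂ ≠ 0 →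
        (∃ z ∈ R', z - t ∈ Ideal.span {f₁, f₂}) ∧
        (c ∈ Ideal.span {f₁, f₂} → ∃ z ∈ R', f₂ ∣ c - f₁ * z)) := by
  by_cases h : f₁ ∈ R ∧ f₂ ∈ R ∧ c ∈ R ∧ CoprimeMod f₁ f₂ ∧ f₂ ≠ 0
  swap
  · exact ⟨R, hR, le_rfl, le_max_left _ _, fun h1 h2 h3 h4 h5 => absurd ⟨h1, h2, h3, h4, h5⟩ h⟩
  obtain ⟨hf₁, hf₂, hc, hf, h0⟩ := h
  have h0' : (⟨f₂, hf₂⟩ : R) ≠ 0 := fun h => h0 (congrArg Subtype.val h)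
  obtain ⟨R', hR', hRR', hcard', z, hz, hzt⟩ :=
    hR.exists_extend_approx hP hcard hx hxP hu hux (f₁ := ⟨f₁, hf₁⟩) (f₂ := ⟨f₂, hf₂⟩) hf h0' t
  by_cases hcf : c ∈ Ideal.span {f₁, f₂}
  swap
  · exact ⟨R', hR', hRR', hcard', fun _ _ _ _ _ => ⟨⟨z, hz, hzt⟩, fun h => absurd h hcf⟩⟩
  have h0'' : (⟨f₂, hRR' hf₂⟩ : R') ≠ 0 := fun h => h0 (congrArg Subtype.val h)
  obtain ⟨R'', hR'', hRR'', hcard'', w, hw, hwc⟩ :=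
    hR'.exists_extend_solve hP
      (hcard'.trans_lt (max_lt hcard (aleph0_lt_mk_nat_arrow _))) hx hxP hu hux
      (f₁ := ⟨f₁, hRR' hf₁⟩) (f₂ := ⟨f₂, hRR' hf₂⟩) hf h0'' (c := ⟨c, hRR' hc⟩) hcf
  exact ⟨R'', hR'', hRR'.trans hRR'', hcard''.trans (max_le hcard' (le_max_right _ _)),
    fun _ _ _ _ _ => ⟨⟨z, hRR'' hz, hzt⟩, fun _ => ⟨w, hw, hwc⟩⟩⟩

theorem exists_isClosedSubring (p : ℕ) [Fact p.Prime] [CharP S p]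
    (hP : ∀ s ∉ P, s ∈ nonZeroDivisors S) {x u : S} (hx : x ∈ maximalIdeal S) (hxP : x ∉ P)
    (hu : u ∈ maximalIdeal S) (hux : CoprimeMod u x) :
    ∃ A : Subring S, IsClosedSubring P A := by
  have hκ := aleph0_lt_mk_nat_arrow (ResidueField S)
  have hbot : IsGoodSubring P (⊥ : Subring S) := isGoodSubring_bot (Ideal.IsPrime.ne_top ‹_›) p
  have hbot_card : #(⊥ : Subring S) ≤ ℵ₀ := by
    have : Countable (⊥ : Subring S) := by
      refine Function.Surjective.countable
        (f := fun n : ℤ => (⟨n, Subring.mem_bot.2 ⟨n, rfl⟩⟩ : (⊥ : Subring S))) ?_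
      rintro ⟨s, hs⟩
      obtain ⟨n, rfl⟩ := Subring.mem_bot.1 hs
      exact ⟨n, rfl⟩
    exact Cardinal.mk_le_aleph0
  obtain ⟨R₁, hR₁, -, hR₁c, g₂, hg₂, hg₂m, hg₂0, -⟩ :=
    hbot.exists_extend_coprime hP (hbot_card.trans_lt hκ) hx hxP hu hux
  replace hR₁c := hR₁c.trans (max_le hbot_card le_rfl)
  obtain ⟨R₀, hR₀, hR₁₀, hR₀c, g₁, hg₁, hg₁m, hg₁0, hg₁₂⟩ :=
    hR₁.exists_extend_coprime hP (hR₁c.trans_lt hκ) hx hxP hu hux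
  replace hR₀c := hR₀c.trans (max_le hR₁c le_rfl)
  have hg := hg₁₂ ⟨g₂, hg₂⟩ fun h => hg₂0 (congrArg Subtype.val h)
  have hS := mk_le_mk_nat_arrow_residueField (S := S)
  have hτ : #(S × S × S × S) ≤ #(ℕ → ResidueField S) := by
    simp only [Cardinal.mk_prod, Cardinal.lift_id]
    exact Cardinal.mul_le_of_le hκ.le hS (Cardinal.mul_le_of_le hκ.le hS
      (Cardinal.mul_le_of_le hκ.le hS hS))
  obtain ⟨A, hA, hRA, hD⟩ := exists_transfinite_union hκ hτ (𝒢 := IsGoodSubring P)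
    (fun F hF h => IsGoodSubring.iSup hF h)
    (fun (t : S × S × S × S) R hR hcard => hR.exists_extend_step hP hcard hx hxP hu hux
      t.1 t.2.1 t.2.2.1 t.2.2.2) hR₀ hR₀c
  refine ⟨A, hA, ⟨⟨g₁, hRA hg₁⟩, ⟨g₂, hRA (hR₁₀ hg₂)⟩, hg₁m, hg₂m, ?_, ?_, hg⟩, ?_, ?_⟩
  · exact fun h => hg₁0 (congrArg Subtype.val h)
  · exact fun h => hg₂0 (congrArg Subtype.val h)
  · intro f₁ f₂ hf h0 t
    obtain ⟨R, R', h₁, h₂, h₃, hR'A, h⟩ :=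
      hD (f₁, f₂, f₁, t) f₁ f₁.2 f₂ f₂.2 f₁ f₁.2
    obtain ⟨z, hz, hzt⟩ := (h h₁ h₂ h₃ hf (by simpa using h0)).1
    exact ⟨⟨z, hR'A hz⟩, hzt⟩
  · intro f₁ f₂ c hf h0 hc
    obtain ⟨R, R', h₁, h₂, h₃, hR'A, h⟩ :=
      hD (f₁, f₂, c, 0) f₁ f₁.2 f₂ f₂.2 c c.2
    obtain ⟨z, hz, hzt⟩ := (h h₁ h₂ h₃ hf (by simpa using h0)).2 hc
    exact ⟨⟨z, hR'A hz⟩, hzt⟩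

end Precompletion

section Completion

variable {A S : Type*} [CommRing A] [IsLocalRing A] [CommRing S] [IsLocalRing S]
  [IsAdicComplete (maximalIdeal S) S]

theorem AdicCompletion.sub_mem_pow {R : Type*} [CommRing R] {I : Ideal R}
    (f : AdicCompletion.AdicCauchySequence I R) {m n : ℕ} (h : m ≤ n) : f n - f m ∈ I ^ m := by
  have := SModEq.sub_mem.1 (f.property h)
  rw [smul_eq_mul, Ideal.mul_top, ← neg_sub] at this
  simpa using neg_mem this

/-- A local ring whose powers of the maximal ideal are contracted from those of a complete local
ring `S` and which is dense in `S` has completion `S`. -/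
theorem nonempty_adicCompletion_ringEquiv (φ : A →+* S)
    (hmem : ∀ n a, φ a ∈ maximalIdeal S ^ n ↔ a ∈ maximalIdeal A ^ n)
    (hdense : ∀ n s, ∃ a, φ a - s ∈ maximalIdeal S ^ n) :
    Nonempty (AdicCompletion (maximalIdeal A) A ≃+* S) := by
  let g (n : ℕ) : AdicCompletion (maximalIdeal A) A →+* S ⧸ maximalIdeal S ^ n :=
    (Ideal.quotientMap (maximalIdeal S ^ n) φ fun a ha => (hmem n a).2 ha).comp
      (AdicCompletion.evalₐ (maximalIdeal A) n).toRingHom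
  have hg : ∀ n (f : AdicCompletion.AdicCauchySequence (maximalIdeal A) A),
      g n (AdicCompletion.mk _ _ f) = Ideal.Quotient.mk _ (φ (f n)) := by
    intro n f
    simp only [g, RingHom.comp_apply, AlgHom.toRingHom_eq_coe, RingHom.coe_coe,
      AdicCompletion.evalₐ_mk]
    exact Ideal.quotientMap_mk
  have hcomp : ∀ {m n : ℕ} (hle : m ≤ n),
      (Ideal.Quotient.factorPow (maximalIdeal S) hle).comp (g n) = g m := by
    intro m n hle
    ext x
    induction x using AdicCompletion.induction_on with
    | _ f =>
    rw [RingHom.comp_apply, hg, hg]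
    change Ideal.Quotient.mk _ (φ (f n)) = _
    rw [Ideal.Quotient.eq, ← map_sub, hmem]
    exact AdicCompletion.sub_mem_pow f hle
  let ψ := IsAdicComplete.liftRingHom (maximalIdeal S) g hcomp
  have hψ : ∀ n x, Ideal.Quotient.mk (maximalIdeal S ^ n) (ψ x) = g n x := fun n x =>
    IsAdicComplete.mk_liftRingHom (maximalIdeal S) g hcomp n x
  refine ⟨RingEquiv.ofBijective ψ ⟨?_, fun s => ?_⟩⟩
  · rw [injective_iff_map_eq_zero]
    intro x hx
    induction x using AdicCompletion.induction_on with
    | _ f =>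
    refine AdicCompletion.ext_evalₐ fun n => ?_
    have h1 := hψ n (AdicCompletion.mk _ _ f)
    rw [hx, map_zero, hg, eq_comm, Ideal.Quotient.eq_zero_iff_mem, hmem] at h1
    rw [AdicCompletion.evalₐ_mk, map_zero, Ideal.Quotient.eq_zero_iff_mem]
    exact h1
  · choose a ha using fun n => hdense n s
    have hc : ∀ n, a n ≡ a (n + 1) [SMOD (maximalIdeal A ^ n • ⊤ : Submodule A A)] := by
      intro n
      rw [SModEq.sub_mem, smul_eq_mul, Ideal.mul_top, ← hmem, map_sub]
      have := sub_mem (ha n) (Ideal.pow_le_pow_right n.le_succ (ha (n + 1)))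
      rwa [sub_sub_sub_cancel_right] at this
    refine ⟨AdicCompletion.mk _ _ (AdicCompletion.AdicCauchySequence.mk _ _ a hc), ?_⟩
    rw [← sub_eq_zero]
    refine eq_zero_of_forall_mem_pow fun n => ?_
    rw [← Ideal.Quotient.eq, hψ, hg, Ideal.Quotient.eq]
    exact ha n

end Completion

namespace IsClosedSubring

variable {S : Type*} [CommRing S] [IsLocalRing S] {P : Ideal S} {A : Subring S}

theorem mem_of_mem_map_of_coprimeMod (hA : IsClosedSubring P A) {I : Ideal A} {f₁ f₂ : A}
    (hf₁ : f₁ ∈ I) (hf₂ : f₂ ∈ I) (hf : CoprimeMod (f₁ : S) f₂) (h0 : f₂ ≠ 0) {a : A}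
    (ha : (a : S) ∈ I.map A.subtype) : a ∈ I := by
  have key : ∀ s ∈ I.map A.subtype, ∃ i ∈ I, s - i ∈ Ideal.span {(f₁ : S), (f₂ : S)} := by
    have hle : Ideal.span {(f₁ : S), (f₂ : S)} ≤ I.map A.subtype := by
      rw [Ideal.span_le]
      rintro s (rfl | rfl)
      · exact Ideal.mem_map_of_mem A.subtype hf₁
      · exact Ideal.mem_map_of_mem A.subtype hf₂
    intro s hs
    induction hs using Submodule.span_induction with
    | mem s hs =>
      obtain ⟨i, hi, rfl⟩ := hs
      exact ⟨i, hi, by simp⟩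
    | zero => exact ⟨0, I.zero_mem, by simp⟩
    | add s t _ _ hs ht =>
      obtain ⟨i, hi, hsi⟩ := hs
      obtain ⟨j, hj, htj⟩ := ht
      refine ⟨i + j, I.add_mem hi hj, ?_⟩
      have := add_mem hsi htj
      rwa [sub_add_sub_comm] at this
    | smul r s _ hs =>
      obtain ⟨i, hi, hsi⟩ := hs
      obtain ⟨z, hz⟩ := hA.approx f₁ f₂ hf h0 r
      refine ⟨z * i, I.mul_mem_left z hi, ?_⟩
      have h1 : r • s - ((z * i : A) : S) = r * (s - i) - i * (z - r) := by
        rw [Subring.coe_mul, smul_eq_mul]; ring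
      rw [h1]
      exact sub_mem (Ideal.mul_mem_left _ _ hsi) (Ideal.mul_mem_left _ _ hz)
  obtain ⟨i, hi, hai⟩ := key a ha
  obtain ⟨z, hz⟩ := hA.solve f₁ f₂ (a - i) hf h0 hai
  obtain ⟨w, hw⟩ := hA.toIsGoodSubring.dvd_of_coe_dvd (a := f₂) (b := a - i - f₁ * z) hz
  have : a = i + z * f₁ + w * f₂ := by linear_combination hw
  rw [this]
  exact add_mem (add_mem hi (I.mul_mem_left _ hf₁)) (I.mul_mem_left _ hf₂)

theorem isLocalHom (hA : IsClosedSubring P A) : IsLocalHom A.subtype := by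
  refine ⟨fun a ha => ?_⟩
  obtain ⟨b, hb⟩ := ha.exists_right_inv
  have h0 : (a : S) ≠ 0 := ha.ne_zero
  have hbA : b ∈ A := hA.mem_of_mul_mem a a.2 h0 b (by
    change A.subtype a * b ∈ A
    rw [hb]
    exact one_mem A)
  exact IsUnit.of_mul_eq_one (⟨b, hbA⟩ : A) (Subtype.ext hb)

theorem isLocalRing (hA : IsClosedSubring P A) : IsLocalRing A :=
  have := hA.isLocalHom
  A.subtype.domain_isLocalRing

theorem mem_maximalIdeal_iff (hA : IsClosedSubring P A) [IsLocalRing A] {a : A} :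
    a ∈ maximalIdeal A ↔ (a : S) ∈ maximalIdeal S := by
  have := hA.isLocalHom
  rw [mem_maximalIdeal, mem_maximalIdeal, mem_nonunits_iff, mem_nonunits_iff]
  exact not_congr (isUnit_map_iff A.subtype a).symm

theorem exists_pow_pair (hA : IsClosedSubring P A) (hP : ∀ s ∉ P, s ∈ nonZeroDivisors S)
    [IsLocalRing A] (n : ℕ) :
    ∃ f₁ ∈ maximalIdeal A ^ n, ∃ f₂ ∈ maximalIdeal A ^ n, f₂ ≠ 0 ∧ CoprimeMod (f₁ : S) f₂ := by
  have := hA.toIsGoodSubring.isDomain hP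
  obtain ⟨f₁, f₂, h1, h2, h10, h20, h⟩ := hA.exists_pair
  refine ⟨f₁ ^ n, Ideal.pow_mem_pow (hA.mem_maximalIdeal_iff.2 h1) n, f₂ ^ n,
    Ideal.pow_mem_pow (hA.mem_maximalIdeal_iff.2 h2) n, pow_ne_zero n h20, ?_⟩
  rw [Subring.coe_pow, Subring.coe_pow]
  exact h.pow (hA.toIsGoodSubring.mem_nonZeroDivisors hP h10)
    (hA.toIsGoodSubring.mem_nonZeroDivisors hP h20) n

theorem exists_sub_mem_map_pow (hA : IsClosedSubring P A) (hP : ∀ s ∉ P, s ∈ nonZeroDivisors S)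
    [IsLocalRing A] (n : ℕ) (s : S) :
    ∃ a : A, (a : S) - s ∈ (maximalIdeal A ^ n).map A.subtype := by
  obtain ⟨f₁, h1, f₂, h2, h20, h⟩ := hA.exists_pow_pair hP n
  obtain ⟨z, hz⟩ := hA.approx f₁ f₂ h h20 s
  refine ⟨z, (Ideal.span_le.2 ?_ : Ideal.span _ ≤ _) hz⟩
  rintro s (rfl | rfl)
  · exact Ideal.mem_map_of_mem A.subtype h1
  · exact Ideal.mem_map_of_mem A.subtype h2

theorem map_maximalIdeal (hA : IsClosedSubring P A) (hP : ∀ s ∉ P, s ∈ nonZeroDivisors S)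
    [IsLocalRing A] : (maximalIdeal A).map A.subtype = maximalIdeal S := by
  have hle : (maximalIdeal A).map A.subtype ≤ maximalIdeal S :=
    Ideal.map_le_iff_le_comap.2 fun a ha => hA.mem_maximalIdeal_iff.1 ha
  refine hle.antisymm fun s hs => ?_
  obtain ⟨a, ha⟩ := hA.exists_sub_mem_map_pow hP 1 s
  rw [pow_one] at ha
  have ham : a ∈ maximalIdeal A := hA.mem_maximalIdeal_iff.2 (by simpa using add_mem (hle ha) hs)
  simpa using sub_mem (Ideal.mem_map_of_mem A.subtype ham) ha

variable [IsNoetherianRing S]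

theorem isNoetherianRing (hA : IsClosedSubring P A) (hP : ∀ s ∉ P, s ∈ nonZeroDivisors S) :
    IsNoetherianRing A := by
  classical
  have := hA.toIsGoodSubring.isDomain hP
  have := hA.toIsGoodSubring.uniqueFactorizationMonoid hP
  refine IsNoetherianRing.of_prime fun Q hQ => ?_
  by_cases hQ0 : Q = ⊥
  · rw [hQ0]
    exact Submodule.fg_bot
  obtain ⟨π, hπQ, hπ⟩ := hQ.exists_mem_prime_of_ne_bot hQ0
  by_cases hQπ : Q ≤ Ideal.span {π}
  · rw [hQπ.antisymm ((Ideal.span_singleton_le_iff_mem Q).2 hπQ)]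
    exact ⟨{π}, by simp⟩
  obtain ⟨b, hbQ, hb⟩ := SetLike.not_le_iff_exists.1 hQπ
  rw [Ideal.mem_span_singleton] at hb
  have hb0 : b ≠ 0 := by
    rintro rfl
    exact hb (dvd_zero π)
  have hcop : CoprimeMod (π : S) b := hA.toIsGoodSubring.coprimeMod_of_isRelPrime hP hπ.ne_zero hb0
    (hπ.irreducible.isRelPrime_iff_not_dvd.2 hb)
  have hfg : (Ideal.span (A.subtype '' (Q : Set A))).FG := IsNoetherian.noetherian _
  obtain ⟨s, hs, hspan⟩ := (Submodule.fg_span_iff_fg_span_finset_subset _).1 hfg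
  obtain ⟨t, ht, rfl⟩ := Finset.subset_set_image_iff.1 hs
  refine ⟨insert π (insert b t), le_antisymm (Submodule.span_le.2 ?_) fun a ha => ?_⟩
  · intro a ha
    simp only [Finset.coe_insert, Set.mem_insert_iff] at ha
    rcases ha with rfl | rfl | ha
    · exact hπQ
    · exact hbQ
    · exact ht ha
  · refine hA.mem_of_mem_map_of_coprimeMod (f₁ := π) (f₂ := b) (Ideal.subset_span (by simp))
      (Ideal.subset_span (by simp)) hcop hb0 ?_
    have h1 : (a : S) ∈ Submodule.span S (A.subtype '' (Q : Set A)) :=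
      Submodule.subset_span ⟨a, ha, rfl⟩
    rw [hspan] at h1
    refine (Submodule.span_le.2 ?_ : Submodule.span S _ ≤ _) h1
    intro x hx
    rw [Finset.coe_image] at hx
    obtain ⟨y, hy, rfl⟩ := hx
    exact Ideal.mem_map_of_mem A.subtype (Ideal.subset_span (by simp [Finset.mem_coe.1 hy]))

/-- Every ideal of `A` is contracted from `S`. -/
theorem mem_of_mem_map (hA : IsClosedSubring P A) (hP : ∀ s ∉ P, s ∈ nonZeroDivisors S)
    {I : Ideal A} {a : A} (ha : (a : S) ∈ I.map A.subtype) : a ∈ I := by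
  have := hA.isLocalRing
  have := hA.isNoetherianRing hP
  refine mem_of_forall_mem_sup_pow fun n => ?_
  obtain ⟨f₁, h1, f₂, h2, h20, h⟩ := hA.exists_pow_pair hP n
  exact hA.mem_of_mem_map_of_coprimeMod (Ideal.mem_sup_right h1) (Ideal.mem_sup_right h2) h h20
    (Ideal.map_mono le_sup_left ha)

theorem nonempty_ringEquiv [IsAdicComplete (maximalIdeal S) S] (hA : IsClosedSubring P A)
    (hP : ∀ s ∉ P, s ∈ nonZeroDivisors S) [IsLocalRing A] :
    Nonempty (AdicCompletion (maximalIdeal A) A ≃+* S) := by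
  have hmap : ∀ n, (maximalIdeal A ^ n).map A.subtype = maximalIdeal S ^ n := fun n => by
    rw [Ideal.map_pow, hA.map_maximalIdeal hP]
  refine nonempty_adicCompletion_ringEquiv A.subtype (fun n a => ⟨fun h => ?_, fun h => ?_⟩)
    fun n s => ?_
  · rw [← hmap] at h
    exact hA.mem_of_mem_map hP h
  · rw [← hmap]
    exact Ideal.mem_map_of_mem A.subtype h
  · rw [← hmap]
    exact hA.exists_sub_mem_map_pow hP n s

end IsClosedSubring

section PowerSeriesLocal

open PowerSeries

theorem coprimeMod_C_X {T : Type*} [CommRing T] {r : T} (hr : RegularMod (⊥ : Ideal T) r) :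
    CoprimeMod (C r : T⟦X⟧) X := by
  intro x hx
  rw [X_dvd_iff, map_mul, constantCoeff_C] at hx
  rw [X_dvd_iff]
  exact hr _ hx

variable {T : Type*} [CommRing T] [IsLocalRing T]

theorem mem_maximalIdeal_pow_of_coeff {n : ℕ} {f : T⟦X⟧}
    (h : ∀ i < n, coeff i f ∈ maximalIdeal T ^ (n - i)) : f ∈ maximalIdeal T⟦X⟧ ^ n := by
  obtain ⟨g, hg⟩ := eq_X_pow_mul_add_sum n f
  rw [hg]
  refine add_mem (Ideal.mul_mem_right _ _ (Ideal.pow_mem_pow X_mem_maximalIdeal n))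
    (Ideal.sum_mem _ fun i hi => ?_)
  rw [Finset.mem_range] at hi
  have := Ideal.mul_mem_mul (C_mem_maximalIdeal_pow (h i hi))
    (Ideal.pow_mem_pow (X_mem_maximalIdeal (T := T)) i)
  rwa [← pow_add, Nat.sub_add_cancel hi.le] at this

theorem isAdicComplete_powerSeries [IsNoetherianRing T] [IsAdicComplete (maximalIdeal T) T] :
    IsAdicComplete (maximalIdeal T⟦X⟧) T⟦X⟧ := by
  have hhaus : IsHausdorff (maximalIdeal T⟦X⟧) T⟦X⟧ :=
    IsHausdorff.of_isLocalRing _ _ (maximalIdeal.isMaximal _).ne_top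
  have hprec : IsPrecomplete (maximalIdeal T⟦X⟧) T⟦X⟧ := by
    refine ⟨fun f hf => ?_⟩
    have hf' : ∀ {m n}, m ≤ n → f n - f m ∈ maximalIdeal T⟦X⟧ ^ m := by
      intro m n h
      have := SModEq.sub_mem.1 (hf h)
      rw [smul_eq_mul, Ideal.mul_top, ← neg_sub] at this
      simpa using neg_mem this
    have hlim : ∀ i, ∃ L, ∀ n, L - coeff i (f (n + i)) ∈ maximalIdeal T ^ n := by
      intro i
      refine exists_limit fun n => ?_
      have h1 : n + i ≤ n + 1 + i := by omega
      have := coeff_mem_pow_of_mem_maximalIdeal_pow (hf' h1) i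
      rwa [Nat.add_sub_cancel, map_sub] at this
    choose L hL using hlim
    refine ⟨PowerSeries.mk L, fun n => ?_⟩
    rw [SModEq.sub_mem, smul_eq_mul, Ideal.mul_top, ← neg_sub]
    refine neg_mem (mem_maximalIdeal_pow_of_coeff fun i hi => ?_)
    have := hL i (n - i)
    rw [Nat.sub_add_cancel hi.le] at this
    rwa [map_sub, coeff_mk]
  exact { hhaus, hprec with }

/-- The prime ideal of power series all of whose coefficients lie in the maximal ideal. -/
noncomputable def residueKer (T : Type*) [CommRing T] [IsLocalRing T] : Ideal T⟦X⟧ :=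
  RingHom.ker (PowerSeries.map (residue T))

instance residueKer_isPrime : (residueKer T).IsPrime := RingHom.ker_isPrime _

theorem mem_residueKer {f : T⟦X⟧} : f ∈ residueKer T ↔ ∀ i, coeff i f ∈ maximalIdeal T := by
  rw [residueKer, RingHom.mem_ker, PowerSeries.ext_iff]
  simp

theorem X_notMem_residueKer : (X : T⟦X⟧) ∉ residueKer T := by
  rw [residueKer, RingHom.mem_ker, PowerSeries.map_X]
  exact X_ne_zero

theorem exists_isUnit_coeff {f : T⟦X⟧} (hf : f ∉ residueKer T) : ∃ j, IsUnit (coeff j f) := by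
  rw [mem_residueKer] at hf
  push Not at hf
  obtain ⟨j, hj⟩ := hf
  exact ⟨j, notMem_maximalIdeal.1 hj⟩

theorem mem_nonZeroDivisors_of_notMem_residueKer [IsAdicComplete (maximalIdeal T) T] (f : T⟦X⟧)
    (hf : f ∉ residueKer T) : f ∈ nonZeroDivisors T⟦X⟧ := by
  classical
  have hex := exists_isUnit_coeff hf
  set j := Nat.find hex with hj
  have hju : IsUnit (coeff j f) := Nat.find_spec hex
  have hlt : ∀ a < j, coeff a f ∈ maximalIdeal T := fun a ha =>
    (mem_maximalIdeal _).2 (Nat.find_min hex ha)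
  rw [mem_nonZeroDivisors_iff_right]
  intro g hg
  have key : ∀ n i, coeff i g ∈ maximalIdeal T ^ n := by
    intro n
    induction n with
    | zero => simp
    | succ n ih =>
      intro i
      induction i using Nat.strong_induction_on with
      | _ i ihi =>
      have h0 : coeff (j + i) (f * g) = 0 := by rw [mul_comm, hg, map_zero]
      have hmem : (j, i) ∈ Finset.HasAntidiagonal.antidiagonal (j + i) :=
        Finset.HasAntidiagonal.mem_antidiagonal.2 rfl
      rw [coeff_mul, ← Finset.add_sum_erase _ _ hmem] at h0
      have hrest : ∑ x ∈ (Finset.HasAntidiagonal.antidiagonal (j + i)).erase (j, i),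
          coeff x.1 f * coeff x.2 g ∈ maximalIdeal T ^ (n + 1) := by
        refine Ideal.sum_mem _ fun x hx => ?_
        obtain ⟨hne, hx⟩ := Finset.mem_erase.1 hx
        have hx := Finset.HasAntidiagonal.mem_antidiagonal.1 hx
        rcases lt_trichotomy x.1 j with h | h | h
        · rw [pow_succ']
          exact Ideal.mul_mem_mul (hlt _ h) (ih _)
        · exact absurd (Prod.ext h (by simp only; omega)) hne
        · exact Ideal.mul_mem_left _ _ (ihi x.2 (by omega))
      rw [eq_neg_of_add_eq_zero_right h0, neg_mem_iff] at hrest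
      exact (Ideal.unit_mul_mem_iff_mem _ hju).1 hrest
  ext i
  rw [map_zero]
  exact eq_zero_of_forall_mem_pow fun n => key n i

theorem IsCohenMacaulayLocal.exists_regularMod_bot (hCM : IsCohenMacaulayLocal T)
    (hdim : 1 ≤ ringKrullDim T) : ∃ r ∈ maximalIdeal T, RegularMod (⊥ : Ideal T) r := by
  obtain ⟨rs, hm, hreg, hlen⟩ := hCM
  have hd := DepthModGE.of_isWeaklyRegular hm hreg.toIsWeaklyRegular
  have h1 : 1 ≤ rs.length := by
    rw [← hlen] at hdim
    exact Nat.one_le_cast.1 hdim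
  obtain ⟨n, hn⟩ := Nat.exists_eq_add_of_le' h1
  rw [hn] at hd
  obtain ⟨r, hrm, hr, -⟩ := hd
  exact ⟨r, hrm, hr⟩

end PowerSeriesLocal

section FRegularity

theorem Ideal.pow_mem_frobPow {R : Type*} [CommRing R] {I : Ideal R} {a : R} (ha : a ∈ I) (q : ℕ) :
    a ^ q ∈ I.frobPow q := Ideal.subset_span ⟨a, ha, rfl⟩

theorem Ideal.map_frobPow_le {R S : Type*} [CommRing R] [CommRing S] (φ : R →+* S) (I : Ideal R)
    (q : ℕ) : (I.frobPow q).map φ ≤ (I.map φ).frobPow q := by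
  rw [Ideal.map_le_iff_le_comap, Ideal.frobPow, Ideal.span_le]
  rintro _ ⟨a, ha, rfl⟩
  change φ (a ^ q) ∈ (I.map φ).frobPow q
  rw [map_pow]
  exact Ideal.pow_mem_frobPow (Ideal.mem_map_of_mem φ ha) q

theorem IsLocalization.frobPow_le_map {R L : Type*} [CommRing R] (M : Submonoid R) [CommRing L]
    [Algebra R L] [IsLocalization M L] (I : Ideal L) (q : ℕ) :
    I.frobPow q ≤ ((I.comap (algebraMap R L)).frobPow q).map (algebraMap R L) := by
  rw [Ideal.frobPow, Ideal.span_le]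
  rintro _ ⟨r, hr, rfl⟩
  obtain ⟨a, s, rfl⟩ := IsLocalization.exists_mk'_eq M r
  have ha : a ∈ I.comap (algebraMap R L) := by
    rw [Ideal.mem_comap, ← IsLocalization.mk'_spec' L a s]
    exact I.mul_mem_left _ hr
  change IsLocalization.mk' L a s ^ q ∈ _
  rw [IsLocalization.mk'_eq_mul_mk'_one, mul_pow, ← map_pow]
  exact Ideal.mul_mem_right _ _ (Ideal.mem_map_of_mem _ (Ideal.pow_mem_frobPow ha q))

/-- A domain in which every nonzero `c` tests ideal membership through infinitely many Frobenius
powers is F-regular. -/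
theorem fRegular_of_forall_exists {A : Type*} [CommRing A] [IsDomain A] {p : ℕ} (hp : p.Prime)
    (h : ∀ c : A, c ≠ 0 → ∀ E, ∃ e, E ≤ e ∧ ∀ (I : Ideal A) (z : A),
      c * z ^ p ^ e ∈ I.frobPow (p ^ e) → z ∈ I) : FRegular A p := by
  intro M I x hx
  by_cases h0 : (0 : A) ∈ M
  · have := IsLocalization.subsingleton (S := Localization M) h0
    rw [Subsingleton.elim x 0]
    exact I.zero_mem
  have := IsLocalization.isDomain_localization (le_nonZeroDivisors_of_noZeroDivisors h0)
  obtain ⟨c, hc, E, hE⟩ := hx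
  have hc0 : c ≠ 0 := by
    have := hc ⊥ (by rw [IsDomain.minimalPrimes_eq_singleton_bot]; rfl)
    simpa using this
  obtain ⟨c₀, s₀, rfl⟩ := IsLocalization.exists_mk'_eq M c
  obtain ⟨x₀, s₁, rfl⟩ := IsLocalization.exists_mk'_eq M x
  have hc₀ : c₀ ≠ 0 := by
    rintro rfl
    exact hc0 (IsLocalization.mk'_zero s₀)
  obtain ⟨e, he, hI⟩ := h c₀ hc₀ E
  set q := p ^ e with hq
  have hqpos : 0 < q := pow_pos hp.pos e
  have h1 : algebraMap A (Localization M) (c₀ * x₀ ^ q) ∈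
      ((I.comap (algebraMap A (Localization M))).frobPow q).map
        (algebraMap A (Localization M)) := by
    refine IsLocalization.frobPow_le_map M I q ?_
    rw [map_mul, map_pow, ← IsLocalization.mk'_spec' (Localization M) c₀ s₀,
      ← IsLocalization.mk'_spec' (Localization M) x₀ s₁, mul_pow, mul_mul_mul_comm]
    exact Ideal.mul_mem_left _ _ (hE e he)
  obtain ⟨s, hs, hmem⟩ := (IsLocalization.algebraMap_mem_map_algebraMap_iff M _ _ _).1 h1
  have h2 : c₀ * (s * x₀) ^ q ∈ (I.comap (algebraMap A (Localization M))).frobPow q := by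
    have := Ideal.mul_mem_left _ (s ^ (q - 1)) hmem
    obtain ⟨k, hk⟩ := Nat.exists_eq_add_of_le' hqpos
    rw [hk] at this ⊢
    convert this using 1
    rw [Nat.add_sub_cancel]
    ring
  have h3 := hI _ _ h2
  rw [Ideal.mem_comap, map_mul, ← IsLocalization.mk'_spec' (Localization M) x₀ s₁,
    ← mul_assoc, ← map_mul] at h3
  exact (Ideal.unit_mul_mem_iff_mem I
    (IsLocalization.map_units (Localization M) ((⟨s, hs⟩ : M) * s₁))).1 h3

open PowerSeries in
theorem IsClosedSubring.fRegular {T : Type*} [CommRing T] [IsLocalRing T] [IsNoetherianRing T]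
    (p : ℕ) [Fact p.Prime] [CharP T p] (hGor : IsGorensteinLocal T) {I₀ : Ideal T}
    (hI₀ : IsParameterIdeal T I₀) {y : T} (hy : IsSocleGenerator I₀ y)
    (h1 : ∀ e : ℕ, y ^ p ^ e ∉ I₀.frobPow (p ^ e)) {A : Subring T⟦X⟧}
    (hA : IsClosedSubring (residueKer T) A)
    (hP : ∀ s ∉ residueKer T, s ∈ nonZeroDivisors T⟦X⟧) : FRegular A p := by
  have hp : p.Prime := Fact.out
  have := hA.toIsGoodSubring.isDomain hP
  refine fRegular_of_forall_exists hp fun c hc E => ?_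
  obtain ⟨j, hj⟩ := exists_isUnit_coeff (hA.toIsGoodSubring.notMem hc)
  refine ⟨max E j, le_max_left _ _, fun I z hz => hA.mem_of_mem_map hP ?_⟩
  refine mem_of_mul_pow_mem_frobPow p hGor hI₀ hy h1 hj (e := max E j) ?_ ?_
  · exact (Nat.lt_pow_self hp.one_lt).trans_le
      (Nat.pow_le_pow_right hp.pos (le_max_right E j))
  · exact Ideal.map_frobPow_le A.subtype I _ (Ideal.mem_map_of_mem A.subtype hz)

end FRegularity

/-- F-regular UFD precompletions of `T[[X]]` for Gorenstein `T`. -/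
theorem FRegular_UFD_powerSeries_precompletion
    (T : Type u) [CommRing T] [IsLocalRing T] [IsNoetherianRing T]
    [IsAdicComplete (maximalIdeal T) T] [IsReduced T]
    (p : ℕ) (hp : p.Prime) [CharP T p]
    (hGor : IsGorensteinLocal T) (hdim : 1 ≤ ringKrullDim T)
    (I : Ideal T) (hIparam : IsParameterIdeal T I)
    (y : T) (hy : IsSocleGenerator I y)
    (h1 : ∀ e : ℕ, y ^ p ^ e ∉ I.frobPow (p ^ e)) :
    ∃ (A : Type u) (_ : CommRing A) (_ : IsDomain A) (_ : IsLocalRing A),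
      UniqueFactorizationMonoid A ∧ IsNoetherianRing A ∧ FRegular A p ∧
      Nonempty (AdicCompletion (maximalIdeal A) A ≃+* PowerSeries T) := by
  have : Fact p.Prime := ⟨hp⟩
  have := isAdicComplete_powerSeries (T := T)
  have hP := mem_nonZeroDivisors_of_notMem_residueKer (T := T)
  obtain ⟨r, hrm, hr⟩ := hGor.1.exists_regularMod_bot hdim
  obtain ⟨A, hA⟩ := exists_isClosedSubring p hP X_mem_maximalIdeal X_notMem_residueKer
    (C_mem_maximalIdeal hrm) (coprimeMod_C_X hr)
  have hloc := hA.isLocalRing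
  have hdom := hA.toIsGoodSubring.isDomain hP
  exact ⟨A, inferInstance, hdom, hloc, hA.toIsGoodSubring.uniqueFactorizationMonoid hP,
    hA.isNoetherianRing hP, hA.fRegular p hGor hIparam hy h1 hP, hA.nonempty_ringEquiv hP⟩
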